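/- Let u ≥ 2 and let F be a fixed nice u-graph with r = v(F) ≥ 4 vertices, and fix g = g(n) with g(n) → ∞ and g(n) = o(log n/log log n). For an instance (H_t)_{t=0}^{M} of the random F-graph process on [n], let 𝓕 denote the set of F-edges of H_{T_H} that have a partner F-edge in H_{T_H + ⌊g(n)·n⌋} \ H_{T_H}. Then one may couple (H_t)_{t=0}^{M} with another instance (H'_t)_{t=0}^{M} of the random F-graph process on [n] such that, with probability tending to 1 as n → ∞, H'_{T_{H'}} ⊆ H_{T_H} \ 𝓕. -/

import Mathlib

open Classical Filter Asymptotics MeasureTheory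
open scoped ENNReal

noncomputable section

/-- The type of potential `F`-edges on vertex set `Fin n`: a pair consisting of the
`r`-element vertex set of the copy and the `u`-edge set of the copy. -/
abbrev FE (n : ℕ) := Finset (Fin n) × Finset (Finset (Fin n))

/-- `F` (a `u`-graph on `Fin r`) is strictly 1-balanced: every proper subgraph `(V', E')`
with more than one vertex has strictly smaller 1-density, i.e.
`e'/(v'-1) < e(F)/(r-1)`, written multiplicatively. -/
def StrictlyOneBalanced {r : ℕ} (F : Finset (Finset (Fin r))) : Prop :=
  ∀ (V' : Finset (Fin r)) (E' : Finset (Finset (Fin r))),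
    E' ⊆ F → (∀ e ∈ E', e ⊆ V') → 1 < V'.card → ¬(V' = Finset.univ ∧ E' = F) →
      E'.card * (r - 1) < F.card * (V'.card - 1)

/-- After deleting the vertices in `S`, the hypergraph `F` is connected. -/
def ConnectedAvoiding {r : ℕ} (F : Finset (Finset (Fin r))) (S : Finset (Fin r)) : Prop :=
  ∀ x y : Fin r, x ∉ S → y ∉ S →
    Relation.ReflTransGen (fun a b => ∃ e ∈ F, Disjoint e S ∧ a ∈ e ∧ b ∈ e) x y

/-- `F` is 3-connected: at least 4 vertices, and no set of at most 2 vertices disconnects it. -/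
def ThreeConnected {r : ℕ} (F : Finset (Finset (Fin r))) : Prop :=
  4 ≤ r ∧ ∀ S : Finset (Fin r), S.card ≤ 2 → ConnectedAvoiding F S

/-- Two edge sets on `Fin r` are isomorphic via a permutation of the vertices. -/
def EdgeIso {r : ℕ} (F F' : Finset (Finset (Fin r))) : Prop :=
  ∃ σ : Equiv.Perm (Fin r), F.image (fun e => e.image (fun x => σ x)) = F'

/-- `F` is nice: strictly 1-balanced, 3-connected and either `u ≥ 3` or `u = 2` and `F`
cannot be transformed into an isomorphic graph by adding one edge and deleting one edge. -/
def Nice {r : ℕ} (u : ℕ) (F : Finset (Finset (Fin r))) : Prop :=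
  StrictlyOneBalanced F ∧ ThreeConnected F ∧
    (3 ≤ u ∨ (u = 2 ∧ ¬ ∃ a b : Finset (Fin r), a.card = u ∧ a ∉ F ∧ b ∈ F ∧
      EdgeIso (insert a (F.erase b)) F))

/-- `h` is an `F`-edge on `[n]`: a copy of `F`, recorded as its (`r`-element) vertex set
together with its `u`-edge set. -/
def IsFEdge {r : ℕ} (F : Finset (Finset (Fin r))) (n : ℕ) (h : FE n) : Prop :=
  ∃ φ : Fin r ↪ Fin n, h.1 = Finset.univ.map φ ∧ h.2 = F.image (fun e => e.map φ)

/-- All possible `F`-edges on `[n]`. -/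
def allFEdges {r : ℕ} (F : Finset (Finset (Fin r))) (n : ℕ) : Finset (FE n) :=
  Finset.univ.filter (fun h => IsFEdge F n h)

/-- `M`, the total number of `F`-edges on `[n]`. -/
def Mnum {r : ℕ} (F : Finset (Finset (Fin r))) (n : ℕ) : ℕ := (allFEdges F n).card

/-- All `u`-element subsets of `[n]`. -/
def allUEdges (u n : ℕ) : Finset (Finset (Fin n)) :=
  Finset.univ.filter (fun e : Finset (Fin n) => e.card = u)

/-- The number of automorphisms of `F`. -/
def autCard {r : ℕ} (F : Finset (Finset (Fin r))) : ℕ :=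
  Fintype.card {σ : Equiv.Perm (Fin r) // F.image (fun e => e.image (fun x => σ x)) = F}

/-- The degree of a vertex `v` in an `F`-graph `H`. -/
def degFE {n : ℕ} (H : Finset (FE n)) (v : Fin n) : ℕ :=
  (H.filter (fun h => v ∈ h.1)).card

/-- Two `F`-edges are partners if their vertex sets share exactly `u` vertices. -/
def Partner (u : ℕ) {n : ℕ} (h h' : FE n) : Prop :=
  h ≠ h' ∧ (h.1 ∩ h'.1).card = u

/-- The state at time `t` of the process induced by the ordering `f`. -/
def proc {α : Type*} [DecidableEq α] {m : ℕ} (f : Fin m → α) (t : ℕ) : Finset α :=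
  (Finset.univ.filter (fun i : Fin m => (i : ℕ) < t)).image f

/-- A valid ordering of all `u`-element subsets of `[n]`. -/
def ValidOrdU (u n : ℕ) (f : Fin (Nat.choose n u) → Finset (Fin n)) : Prop :=
  Function.Injective f ∧ ∀ e : Finset (Fin n), e.card = u → ∃ i, f i = e

/-- A valid ordering of all `r`-element subsets of `[n]`. -/
def ValidOrdR (r n : ℕ) (f : Fin (Nat.choose n r) → Finset (Fin n)) : Prop :=
  Function.Injective f ∧ ∀ e : Finset (Fin n), e.card = r → ∃ i, f i = e

/-- A valid ordering of all `F`-edges on `[n]`. -/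
def ValidOrdH {r : ℕ} (F : Finset (Finset (Fin r))) (n : ℕ)
    (f : Fin (Mnum F n) → FE n) : Prop :=
  Function.Injective f ∧ ∀ h : FE n, IsFEdge F n h → ∃ i, f i = h

/-- `T_H`: the first time at which the `F`-graph process has no isolated vertices. -/
def THit {r : ℕ} (F : Finset (Finset (Fin r))) (n : ℕ) (f : Fin (Mnum F n) → FE n) : ℕ :=
  sInf {t : ℕ | ∀ v : Fin n, ∃ h ∈ proc f t, v ∈ h.1}

/-- `T_E`: the first time at which the `r`-uniform hypergraph process has no isolated
vertices. -/
def TEHit (r n : ℕ) (f : Fin (Nat.choose n r) → Finset (Fin n)) : ℕ :=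
  sInf {t : ℕ | ∀ v : Fin n, ∃ e ∈ proc f t, v ∈ e}

/-- `T_G`: the first time at which every vertex of `[n]` lies in a copy of `F` in the
`u`-graph process. -/
def TGHit (u : ℕ) {r : ℕ} (F : Finset (Finset (Fin r))) (n : ℕ)
    (f : Fin (Nat.choose n u) → Finset (Fin n)) : ℕ :=
  sInf {t : ℕ | ∀ v : Fin n, ∃ h : FE n, IsFEdge F n h ∧ v ∈ h.1 ∧ h.2 ⊆ proc f t}

/-- The random variable `X` is uniformly distributed over `{a | P a}` under `μ`. -/
def UniformOn {Ω α : Type*} (μ : PMF Ω) (X : Ω → α) (P : α → Prop) : Prop :=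
  μ.toOuterMeasure {ω | P (X ω)} = 1 ∧
    ∀ a b : α, P a → P b →
      μ.toOuterMeasure {ω | X ω = a} = μ.toOuterMeasure {ω | X ω = b}

/-- Under `μ`, the random set `X` contains each element of `all` independently with
probability `p` (a Bernoulli product / binomial random subset distribution). -/
def BernoulliVia {Ω E : Type*} (μ : PMF Ω) (X : Ω → Finset E)
    (all : Finset E) (p : ℝ) : Prop :=
  ∀ A : Finset E, μ.toOuterMeasure {ω | X ω = A} =
    if A ⊆ all then ENNReal.ofReal (p ^ A.card * (1 - p) ^ (all.card - A.card)) else 0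

/-- The function `g` tends to infinity and is `o(log n / log log n)`. -/
def GoodG (g : ℕ → ℝ) : Prop :=
  Tendsto g atTop atTop ∧ g =o[atTop] fun n : ℕ => Real.log n / Real.log (Real.log n)

/-- `π₊`, the probability at the end of the critical window. -/
def piPlus {r : ℕ} (F : Finset (Finset (Fin r))) (g : ℕ → ℝ) (n : ℕ) : ℝ :=
  ((autCard F : ℝ) / (Nat.factorial r : ℝ)) *
    ((Real.log n + g n) / ((n - 1).choose (r - 1) : ℝ))

/-- `π₋`, the probability at the start of the critical window. -/
def piMinus {r : ℕ} (F : Finset (Finset (Fin r))) (g : ℕ → ℝ) (n : ℕ) : ℝ :=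
  ((autCard F : ℝ) / (Nat.factorial r : ℝ)) *
    ((Real.log n - g n) / ((n - 1).choose (r - 1) : ℝ))

/-- `p₊ = (π₊/(1-n^{-δ}))^{1/s}` where `s = e(F)`. -/
def pPlus {r : ℕ} (F : Finset (Finset (Fin r))) (g : ℕ → ℝ) (δ : ℝ) (n : ℕ) : ℝ :=
  (piPlus F g n / (1 - (n : ℝ) ^ (-δ))) ^ ((1 : ℝ) / (F.card : ℝ))

/-- Connectivity (as a multihypergraph of vertex sets) of a set of `F`-edges. -/
def ConnFE {n : ℕ} (S : Finset (FE n)) : Prop :=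
  ∀ a ∈ S, ∀ b ∈ S,
    Relation.ReflTransGen (fun x y : FE n => x ∈ S ∧ y ∈ S ∧ (x.1 ∩ y.1).Nonempty) a b

/-- The multihypergraph of vertex sets of the `F`-edges of `H` contains an avoidable
configuration: a connected `S ⊆ H` with nullity `(r-1)e(S)+1-v(S) > 1` and
`e(S) ≤ 2^(r+1)`. -/
def HasAvoidable (r : ℕ) {n : ℕ} (H : Finset (FE n)) : Prop :=
  ∃ S ⊆ H, S.Nonempty ∧ ConnFE S ∧
    (S.sup Prod.fst).card < (r - 1) * S.card ∧ S.card ≤ 2 ^ (r + 1)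

/-- `G` contains an `F`-factor: pairwise vertex-disjoint copies of `F`, each a subgraph
of `G`, whose vertex sets partition `[n]`. -/
def HasFFactor {r : ℕ} (F : Finset (Finset (Fin r))) (n : ℕ)
    (G : Finset (Finset (Fin n))) : Prop :=
  ∃ C : Finset (FE n), (∀ h ∈ C, IsFEdge F n h ∧ h.2 ⊆ G) ∧
    (∀ h ∈ C, ∀ h' ∈ C, h ≠ h' → Disjoint h.1 h'.1) ∧
    C.sup Prod.fst = Finset.univ ∧ C.card * r = n

namespace HC

/-- Average over a finite type. -/
def Ex {α : Type} [Fintype α] (X : α → ℝ) : ℝ := (∑ a, X a) / (Fintype.card α : ℝ)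

/-- Real-valued indicator. -/
def ind (p : Prop) : ℝ := if p then 1 else 0

lemma ind_nonneg (p : Prop) : 0 ≤ ind p := by unfold ind; split_ifs <;> norm_num

lemma ind_le_one (p : Prop) : ind p ≤ 1 := by unfold ind; split_ifs <;> norm_num

lemma ind_true {p : Prop} (h : p) : ind p = 1 := if_pos h

lemma ind_false {p : Prop} (h : ¬ p) : ind p = 0 := if_neg h

lemma ind_mono {p q : Prop} (h : p → q) : ind p ≤ ind q := by
  by_cases hp : p
  · rw [ind_true hp, ind_true (h hp)]
  · rw [ind_false hp]; exact ind_nonneg q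

lemma ind_or {p q s : Prop} (h : p → q ∨ s) : ind p ≤ ind q + ind s := by
  by_cases hp : p
  · rcases h hp with h1 | h1
    · rw [ind_true hp, ind_true h1]; linarith [ind_nonneg s]
    · rw [ind_true hp, ind_true h1]; linarith [ind_nonneg q]
  · rw [ind_false hp]; linarith [ind_nonneg q, ind_nonneg s]

lemma ind_exists {ι : Type} (s : Finset ι) {p : Prop} {q : ι → Prop} (h : p → ∃ i ∈ s, q i) :
    ind p ≤ ∑ i ∈ s, ind (q i) := by
  by_cases hp : p
  · obtain ⟨i, hi, hq⟩ := h hp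
    rw [ind_true hp, ← ind_true hq]
    exact Finset.single_le_sum (f := fun i => ind (q i)) (fun j _ => ind_nonneg _) hi
  · rw [ind_false hp]; exact Finset.sum_nonneg fun j _ => ind_nonneg _

section
variable {α β : Type} [Fintype α] [Fintype β]

lemma Ex_mono {X Y : α → ℝ} (h : ∀ a, X a ≤ Y a) : Ex X ≤ Ex Y := by
  unfold Ex
  gcongr with a
  exact h a

lemma Ex_nonneg {X : α → ℝ} (h : ∀ a, 0 ≤ X a) : 0 ≤ Ex X := by
  unfold Ex
  have := Finset.sum_nonneg fun a (_ : a ∈ Finset.univ) => h a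
  positivity

lemma Ex_add (X Y : α → ℝ) : Ex (fun a => X a + Y a) = Ex X + Ex Y := by
  unfold Ex
  rw [Finset.sum_add_distrib, add_div]

lemma Ex_sub (X Y : α → ℝ) : Ex (fun a => X a - Y a) = Ex X - Ex Y := by
  unfold Ex
  rw [Finset.sum_sub_distrib, sub_div]

lemma Ex_mul (c : ℝ) (X : α → ℝ) : Ex (fun a => c * X a) = c * Ex X := by
  unfold Ex
  rw [← Finset.mul_sum, mul_div_assoc]

lemma Ex_sum {ι : Type} (s : Finset ι) (X : ι → α → ℝ) :
    Ex (fun a => ∑ i ∈ s, X i a) = ∑ i ∈ s, Ex (X i) := by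
  unfold Ex
  rw [Finset.sum_comm, Finset.sum_div]

lemma Ex_const [Nonempty α] (c : ℝ) : Ex (fun _ : α => c) = c := by
  unfold Ex
  rw [Finset.sum_const, nsmul_eq_mul, Finset.card_univ]
  field_simp

lemma Ex_equiv (e : α ≃ β) (X : β → ℝ) : Ex (fun a => X (e a)) = Ex X := by
  unfold Ex
  rw [e.sum_comp, Fintype.card_congr e]

lemma Ex_prod (X : α × β → ℝ) : Ex X = Ex (fun a => Ex (fun b => X (a, b))) := by
  unfold Ex
  rw [Fintype.sum_prod_type, Fintype.card_prod, ← Finset.sum_div, div_div]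
  push_cast
  rw [mul_comm]

lemma Ex_fst [Nonempty β] (X : α → ℝ) : Ex (fun p : α × β => X p.1) = Ex X := by
  rw [Ex_prod]
  simp only [Ex_const]

end

/-! ### Sorting positions -/

lemma lower_mem {M : ℕ} (B : Finset (Fin M)) (hB : ∀ i ∈ B, ∀ j, j ≤ i → j ∈ B) (j : Fin M) :
    j ∈ B ↔ (j : ℕ) < B.card := by
  constructor
  · intro h
    have : Finset.Iic j ⊆ B := fun i hi => hB j h i (Finset.mem_Iic.1 hi)
    have := Finset.card_le_card this
    rw [Fin.card_Iic] at this
    omega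
  · intro h
    by_contra hn
    have : B ⊆ Finset.Iio j := by
      intro i hi
      rw [Finset.mem_Iio]
      by_contra hc
      exact hn (hB i hi j (not_lt.1 hc))
    have := Finset.card_le_card this
    rw [Fin.card_Iio] at this
    omega

lemma sort_lower {M : ℕ} (key : Fin M → ℕ) (A : Finset (Fin M))
    (hA : ∀ i ∈ A, ∀ j, key j ≤ key i → j ∈ A) (j : Fin M) :
    Tuple.sort key j ∈ A ↔ (j : ℕ) < A.card := by
  have h := lower_mem (A.map (Tuple.sort key).symm.toEmbedding) (by
    intro i hi j hj
    rw [Finset.mem_map_equiv, Equiv.symm_symm] at hi ⊢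
    exact hA _ hi _ (Tuple.monotone_sort key hj)) j
  rw [Finset.card_map, Finset.mem_map_equiv, Equiv.symm_symm] at h
  exact h

lemma card_lt {M s : ℕ} (h : s ≤ M) :
    (Finset.univ.filter (fun i : Fin M => (i : ℕ) < s)).card = s := by
  rw [Fin.card_filter_val_lt]; omega

/-- Key used to move the zero-coloured tail positions forward. -/
def rkey {M k : ℕ} [NeZero k] (t : ℕ) (c : Fin M → Fin k) (i : Fin M) : ℕ :=
  if (i : ℕ) < t then (i : ℕ) else if c i = 0 then M + i else 2 * M + i

def rho {M k : ℕ} [NeZero k] (t : ℕ) (c : Fin M → Fin k) : Equiv.Perm (Fin M) :=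
  Tuple.sort (rkey t c)

lemma rho_fix {M k : ℕ} [NeZero k] (t : ℕ) (c : Fin M → Fin k) (i : Fin M) (hi : (i : ℕ) < t) :
    rho t c i = i := by
  have key : ∀ s : ℕ, s ≤ t → s ≤ M → (((rho t c i : Fin M) : ℕ) < s ↔ (i : ℕ) < s) := by
    intro s hs hM
    have := sort_lower (rkey t c) (Finset.univ.filter (fun i : Fin M => (i : ℕ) < s)) (by
      intro a ha b hb
      simp only [Finset.mem_filter, Finset.mem_univ, true_and] at ha ⊢
      unfold rkey at hb
      have := a.2
      have := b.2
      split_ifs at hb <;> omega) i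
    rw [card_lt hM] at this
    simpa [rho] using this
  have h1 := key (i + 1) (by omega) (by have := i.2; omega)
  have h2 := key i (by omega) (by have := i.2; omega)
  apply Fin.ext
  omega

lemma rho_window {M k : ℕ} [NeZero k] (t m : ℕ) (c : Fin M → Fin k)
    (hm : m ≤ (Finset.univ.filter (fun i : Fin M => t ≤ (i : ℕ) ∧ c i = 0)).card)
    (i : Fin M) (h1 : t ≤ (i : ℕ)) (h2 : (i : ℕ) < t + m) :
    c (rho t c i) = 0 ∧ t ≤ (rho t c i : ℕ) := by
  have hge : t ≤ (rho t c i : ℕ) := by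
    by_contra hlt
    have := rho_fix t c (rho t c i) (by omega)
    have := (rho t c).injective this
    rw [this] at hlt
    omega
  refine ⟨?_, hge⟩
  have htM : t ≤ M := by have := i.2; omega
  have := sort_lower (rkey t c) (Finset.univ.filter (fun i : Fin M => (i : ℕ) < t ∨ c i = 0)) (by
      intro a ha b hb
      simp only [Finset.mem_filter, Finset.mem_univ, true_and] at ha ⊢
      unfold rkey at hb
      have := a.2
      have := b.2
      by_contra hcon
      push Not at hcon
      rw [if_neg (by omega), if_neg hcon.2] at hb
      split_ifs at hb <;> omega) i
  have hcard : (Finset.univ.filter (fun i : Fin M => (i : ℕ) < t ∨ c i = 0)).card ≥ t + m := by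
    have hsub : (Finset.univ.filter (fun i : Fin M => (i : ℕ) < t)) ∪
        (Finset.univ.filter (fun i : Fin M => t ≤ (i : ℕ) ∧ c i = 0)) ⊆
        (Finset.univ.filter (fun i : Fin M => (i : ℕ) < t ∨ c i = 0)) := by
      intro x hx
      simp only [Finset.mem_union, Finset.mem_filter, Finset.mem_univ, true_and] at hx ⊢
      tauto
    have h3 := Finset.card_le_card hsub
    rw [Finset.card_union_of_disjoint, card_lt htM] at h3
    · omega
    · rw [Finset.disjoint_filter]
      intro x _ hx hx2
      omega
  have h4 := this.2 (by omega)
  simp only [Finset.mem_filter, Finset.mem_univ, true_and] at h4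
  rcases h4 with h4 | h4
  · change (rho t c i : ℕ) < t at h4
    omega
  · exact h4

/-- Permutation which moves marked positions to the end. -/
def sig {M : ℕ} (S : Fin M → Prop) : Equiv.Perm (Fin M) :=
  Tuple.sort (fun i : Fin M => if S i then M + (i : ℕ) else (i : ℕ))

lemma sig_prefix {M : ℕ} (S : Fin M → Prop) (t : ℕ) (j : Fin M) :
    (((sig S j : Fin M) : ℕ) < t ∧ ¬ S (sig S j)) ↔
      (j : ℕ) < (Finset.univ.filter (fun i : Fin M => (i : ℕ) < t ∧ ¬ S i)).card := by
  have := sort_lower (fun i : Fin M => if S i then M + (i : ℕ) else (i : ℕ))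
    (Finset.univ.filter (fun i : Fin M => (i : ℕ) < t ∧ ¬ S i)) (by
      intro a ha b hb
      simp only [Finset.mem_filter, Finset.mem_univ, true_and] at ha ⊢
      have := a.2
      have := b.2
      rw [if_neg ha.2] at hb
      split_ifs at hb with h
      · omega
      · exact ⟨by omega, h⟩) j
  rw [← this]
  simp [sig]

/-! ### Partial injections extend -/

lemma exists_swap {α β : Type} [Fintype α] [Fintype β] (P : α → Prop) (φ : α → β)
    (hφ : ∀ a b, P a → P b → φ a = φ b → a = b) :
    ∃ e : Equiv.Perm (α ⊕ β), ∀ a, P a → e (Sum.inr (φ a)) = Sum.inl a := by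
  let p : α ⊕ β → Prop := fun x => ∃ a, P a ∧ x = Sum.inr (φ a)
  let q : α ⊕ β → Prop := fun x => ∃ a, P a ∧ x = Sum.inl a
  let g : {x // q x} → {x // p x} := fun x => ⟨Sum.inr (φ x.2.choose), x.2.choose, x.2.choose_spec.1, rfl⟩
  have hg : ∀ a (ha : P a), g ⟨Sum.inl a, a, ha, rfl⟩ = ⟨Sum.inr (φ a), a, ha, rfl⟩ := by
    intro a ha
    have hq : q (Sum.inl a) := ⟨a, ha, rfl⟩
    have := hq.choose_spec
    apply Subtype.ext
    change Sum.inr (φ hq.choose) = Sum.inr (φ a)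
    rw [← Sum.inl.inj this.2]
  have hb : Function.Bijective g := by
    constructor
    · rintro ⟨x, a, ha, rfl⟩ ⟨y, b, hb, rfl⟩ h
      rw [hg a ha, hg b hb] at h
      have h' := Sum.inr.inj (Subtype.ext_iff.1 h)
      have := hφ a b ha hb h'
      subst this
      rfl
    · rintro ⟨x, a, ha, rfl⟩
      exact ⟨⟨Sum.inl a, a, ha, rfl⟩, hg a ha⟩
  let e := Equiv.ofBijective g hb
  refine ⟨e.symm.extendSubtype, fun a ha => ?_⟩
  have hx : p (Sum.inr (φ a)) := ⟨a, ha, rfl⟩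
  rw [Equiv.extendSubtype_apply_of_mem e.symm _ hx]
  have : e.symm ⟨Sum.inr (φ a), hx⟩ = ⟨Sum.inl a, a, ha, rfl⟩ := by
    rw [Equiv.symm_apply_eq]
    exact (hg a ha).symm
  rw [this]

/-! ### The coupling -/

set_option linter.unusedSectionVars false

section
variable {E V : Type} [Fintype E] [Fintype V] {M : ℕ}

def Cov (inc : E → Finset V) (f : Fin M ≃ E) (t : ℕ) : Prop :=
  ∀ v, ∃ i : Fin M, (i : ℕ) < t ∧ v ∈ inc (f i)

def HT (inc : E → Finset V) (f : Fin M ≃ E) : ℕ := sInf {t | Cov inc f t}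

lemma Cov.mono {inc : E → Finset V} {f : Fin M ≃ E} {s t : ℕ} (h : Cov inc f s) (hst : s ≤ t) :
    Cov inc f t := fun v => by
  obtain ⟨i, hi, hv⟩ := h v
  exact ⟨i, by omega, hv⟩

lemma HT_le {inc : E → Finset V} {f : Fin M ≃ E} {t : ℕ} (h : Cov inc f t) : HT inc f ≤ t :=
  Nat.sInf_le h

lemma HT_cov {inc : E → Finset V} {f : Fin M ≃ E} {t : ℕ} (h : Cov inc f t) :
    Cov inc f (HT inc f) := Nat.sInf_mem (s := {t | Cov inc f t}) ⟨t, h⟩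

lemma HT_congr (inc : E → Finset V) (f f' : Fin M ≃ E)
    (h : ∀ i : Fin M, (i : ℕ) < HT inc f → f' i = f i) : HT inc f' = HT inc f := by
  have hc : ∀ t ≤ HT inc f, (Cov inc f t ↔ Cov inc f' t) := by
    intro t ht
    unfold Cov
    refine forall_congr' fun v => exists_congr fun i => and_congr_right fun hi => ?_
    rw [h i (by omega)]
  by_cases hne : ∃ t, Cov inc f t
  · obtain ⟨t, ht⟩ := hne
    have h1 := HT_cov ht
    have h2 := (hc _ le_rfl).1 h1
    apply le_antisymm (HT_le h2)
    by_contra hlt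
    push Not at hlt
    have h3 := (hc _ hlt.le).2 (HT_cov h2)
    have := HT_le h3
    omega
  · have h0 : HT inc f = 0 := by
      unfold HT
      rw [Nat.sInf_eq_zero]
      right
      ext t
      simp only [Set.mem_ofPred_eq, Set.mem_empty_iff_false, iff_false]
      exact fun ht => hne ⟨t, ht⟩
    rw [h0]
    unfold HT
    rw [Nat.sInf_eq_zero]
    right
    ext t
    simp only [Set.mem_ofPred_eq, Set.mem_empty_iff_false, iff_false]
    intro ht
    apply hne
    refine ⟨M, fun v => ?_⟩
    obtain ⟨i, hi, hv⟩ := ht v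
    exact ⟨f.symm (f' i), (f.symm (f' i)).2, by simpa using hv⟩

lemma exists_label (par : E → E → Prop) (D : ℕ) 
    (hD : ∀ h, (Finset.univ.filter (fun h' => par h h')).card ≤ D) :
    ∀ h, ∃ lab : {h' // par h h'} → Fin D, Function.Injective lab := by
  intro h
  have : Fintype.card {h' // par h h'} ≤ Fintype.card (Fin D) := by
    rw [Fintype.card_subtype, Fintype.card_fin]
    exact hD h
  obtain ⟨g⟩ := Function.Embedding.nonempty_of_card_le this
  exact ⟨g, g.injective⟩

lemma exists_match (inc : E → Finset V) (par : E → E → Prop) (D : ℕ)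
    (hD : ∀ h, (Finset.univ.filter (fun h' => par h h')).card ≤ D) (f : Fin M ≃ E) :
    ∃ e : Equiv.Perm (E ⊕ (Fin M × Fin D)), ∀ h' (j : Fin M), (j : ℕ) < HT inc f → par (f j) h' →
      (∀ j' : Fin M, (j' : ℕ) < HT inc f → par (f j') h' → j' = j) →
      ∃ a, e (Sum.inr (j, a)) = Sum.inl h' := by
  choose lab hlab using exists_label par D hD
  by_cases hDp : Nonempty (Fin D)
  · obtain ⟨a0⟩ := hDp
    let P : E → Prop := fun h' => ∃! j : Fin M, (j : ℕ) < HT inc f ∧ par (f j) h'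
    let φ : E → Fin M × Fin D := fun h' => if hP : P h' then
      (hP.choose, lab (f hP.choose) ⟨h', hP.choose_spec.1.2⟩) else (f.symm h', a0)
    obtain ⟨e, he⟩ := exists_swap P φ (by
      intro a b ha hb hab
      simp only [φ, dif_pos ha, dif_pos hb] at hab
      have h1 := (Prod.ext_iff.1 hab).1
      have h2 := (Prod.ext_iff.1 hab).2
      dsimp only at h1 h2
      have hA := ha.choose_spec.1.2
      have hB := hb.choose_spec.1.2
      have gen : ∀ (x y : Fin M) (hxy : x = y) (hx : par (f x) a) (hy : par (f y) b),
          lab (f x) ⟨a, hx⟩ = lab (f y) ⟨b, hy⟩ → a = b := by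
        intro x y hxy hx hy hl
        subst hxy
        exact Subtype.ext_iff.1 (hlab _ hl)
      exact gen _ _ h1 hA hB h2)
    refine ⟨e, fun h' j hj hp hu => ?_⟩
    have hP : P h' := ⟨j, ⟨hj, hp⟩, fun y hy => hu y hy.1 hy.2⟩
    have := he h' hP
    simp only [φ, dif_pos hP] at this
    have hj' : hP.choose = j := hu _ hP.choose_spec.1.1 hP.choose_spec.1.2
    have gen : ∀ x a, x = j → e (Sum.inr (x, a)) = Sum.inl h' → ∃ a, e (Sum.inr (j, a)) = Sum.inl h' := by
      intro x a hx hxa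
      subst hx
      exact ⟨a, hxa⟩
    exact gen _ _ hj' this
  · refine ⟨Equiv.refl _, fun h' j hj hp hu => ?_⟩
    exact absurd ⟨lab (f j) ⟨h', hp⟩⟩ hDp

variable (inc : E → Finset V) (par : E → E → Prop) (D k : ℕ) [NeZero k]

/-- The permutation matching single partners with labels. -/
def mat (hD : ∀ h, (Finset.univ.filter (fun h' => par h h')).card ≤ D) (f : Fin M ≃ E) :
    Equiv.Perm (E ⊕ (Fin M × Fin D)) := (exists_match inc par D hD f).choose

/-- The sample space. -/
abbrev Om (E : Type) (M D k : ℕ) := (Fin M ≃ E) × ((E ⊕ (Fin M × Fin D)) → Fin k)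

def f1 (ω : Om E M D k) : Fin M ≃ E :=
  (rho (HT inc ω.1) (fun i => ω.2 (Sum.inl (ω.1 i)))).trans ω.1

/-- marked positions -/
def Smark {M D k : ℕ} [NeZero k] (c : (E ⊕ (Fin M × Fin D)) → Fin k) (j : Fin M) : Prop :=
  ∃ a, c (Sum.inr (j, a)) = 0

def f2 (hD : ∀ h, (Finset.univ.filter (fun h' => par h h')).card ≤ D) (ω : Om E M D k) : Fin M ≃ E :=
  (sig (Smark (fun x => ω.2 (mat inc par D hD ω.1 x)))).trans ω.1

variable {D k}
lemma HT_f1 (ω : Om E M D k) : HT inc (f1 inc D k ω) = HT inc ω.1 := by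
  apply HT_congr
  intro i hi
  unfold f1
  rw [Equiv.trans_apply, rho_fix _ _ i hi]

lemma fiber_card {O Y Z : Type} [Fintype O] [Fintype Y] [Fintype Z] (hYZ : Fintype.card Y = Fintype.card Z)
    (Φ : O × Y → O × Z) (hΦ : Function.Injective Φ) (a : O) :
    (Finset.univ.filter (fun ω => (Φ ω).1 = a)).card = Fintype.card Z := by
  have hb : Function.Bijective Φ := by
    rw [Fintype.bijective_iff_injective_and_card]
    exact ⟨hΦ, by simp [hYZ]⟩
  rw [← Fintype.card_subtype]
  refine Fintype.card_congr (Equiv.ofBijective (fun ω => (Φ ω.1).2) ⟨?_, ?_⟩)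
  · rintro ⟨x, hx⟩ ⟨y, hy⟩ hxy
    apply Subtype.ext
    exact hΦ (Prod.ext (hx.trans hy.symm) hxy)
  · intro z
    obtain ⟨ω, hω⟩ := hb.2 (a, z)
    exact ⟨⟨ω, by rw [hω]⟩, by simp [hω]⟩

lemma f1_fiber (hM : Fintype.card E = M) (a : Fin M ≃ E) :
    (Finset.univ.filter (fun ω : Om E M D k => f1 inc D k ω = a)).card =
      Fintype.card ((Fin M ⊕ (Fin M × Fin D)) → Fin k) := by
  suffices hinj : Function.Injective (fun ω : Om E M D k =>
      ((f1 inc D k ω, fun x => ω.2 (Sum.map ω.1 id x)) :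
        (Fin M ≃ E) × ((Fin M ⊕ (Fin M × Fin D)) → Fin k))) by
    convert fiber_card (by simp [hM]) _ hinj a
  rintro ⟨f, c⟩ ⟨g, d⟩ h
  have h1 := (Prod.ext_iff.1 h).1
  have h2 := (Prod.ext_iff.1 h).2
  dsimp only at h1 h2
  have hT : HT inc f = HT inc g := by
    rw [← HT_f1 inc (⟨f, c⟩ : Om E M D k), h1, HT_f1 inc (⟨g, d⟩ : Om E M D k)]
  have hc : (fun i => c (Sum.inl (f i))) = (fun i => d (Sum.inl (g i))) := by
    funext i
    exact congrFun h2 (Sum.inl i)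
  unfold f1 at h1
  dsimp only at h1
  rw [hT, hc] at h1
  have hfg : f = g := by
    ext i
    have := congrArg (fun e => e ((rho (HT inc g) fun i => d (Sum.inl (g i))).symm i)) h1
    simpa using this
  subst hfg
  congr 1
  funext x
  rcases x with x | x
  · have := congrFun h2 (Sum.inl (f.symm x))
    simpa using this
  · exact congrFun h2 (Sum.inr x)

lemma f2_fiber (hD : ∀ h, (Finset.univ.filter (fun h' => par h h')).card ≤ D) (a : Fin M ≃ E) :
    (Finset.univ.filter (fun ω : Om E M D k => f2 inc par D k hD ω = a)).card =
      Fintype.card ((E ⊕ (Fin M × Fin D)) → Fin k) := by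
  suffices hinj : Function.Injective (fun ω : Om E M D k =>
      ((f2 inc par D k hD ω, fun x => ω.2 (mat inc par D hD ω.1 x)) :
        (Fin M ≃ E) × ((E ⊕ (Fin M × Fin D)) → Fin k))) by
    convert fiber_card rfl _ hinj a
  rintro ⟨f, c⟩ ⟨g, d⟩ h
  have h1 := (Prod.ext_iff.1 h).1
  have h2 := (Prod.ext_iff.1 h).2
  dsimp only at h1 h2
  unfold f2 at h1
  dsimp only at h1
  rw [h2] at h1
  have hfg : f = g := by
    ext i
    have := congrArg (fun e => e ((sig (Smark (fun x => d (mat inc par D hD g x)))).symm i)) h1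
    simpa using this
  subst hfg
  congr 1
  funext x
  have := congrFun h2 ((mat inc par D hD f).symm x)
  simpa using this

/-- Deterministic analysis of the good event. -/
lemma good_event (hD : ∀ h, (Finset.univ.filter (fun h' => par h h')).card ≤ D)
    (ω : Om E M D k) (m : ℕ)
    (hb : m ≤ (Finset.univ.filter (fun i : Fin M => HT inc ω.1 ≤ (i : ℕ) ∧
      ω.2 (Sum.inl (ω.1 i)) = 0)).card)
    (hc : ∀ h', ω.2 (Sum.inl h') = 0 → ∀ j j' : Fin M, (j : ℕ) < HT inc ω.1 → (j' : ℕ) < HT inc ω.1 →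
      par (ω.1 j) h' → par (ω.1 j') h' → j' = j)
    (hd : ∀ v, ∃ i : Fin M, (i : ℕ) < HT inc ω.1 ∧ v ∈ inc (ω.1 i) ∧
      ¬ Smark (fun x => ω.2 (mat inc par D hD ω.1 x)) i)
    (i : Fin M) (hi : (i : ℕ) < HT inc (f2 inc par D k hD ω)) :
    ∃ j : Fin M, (j : ℕ) < HT inc (f1 inc D k ω) ∧ f2 inc par D k hD ω i = f1 inc D k ω j ∧
      ∀ i' : Fin M, HT inc (f1 inc D k ω) ≤ (i' : ℕ) → (i' : ℕ) < HT inc (f1 inc D k ω) + m →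
        ¬ par (f1 inc D k ω j) (f1 inc D k ω i') := by
  rw [HT_f1]
  set S := Smark (fun x => ω.2 (mat inc par D hD ω.1 x)) with hS
  set t := HT inc ω.1 with ht
  have hcov : Cov inc (f2 inc par D k hD ω)
      (Finset.univ.filter (fun i : Fin M => (i : ℕ) < t ∧ ¬ S i)).card := by
    intro v
    obtain ⟨i, hi, hv, hs⟩ := hd v
    refine ⟨(sig S).symm i, ?_, ?_⟩
    · rw [← sig_prefix]
      simpa using ⟨hi, hs⟩
    · unfold f2
      rw [← hS]
      simpa using hv
  have hle := HT_le hcov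
  have h1 := (sig_prefix S t i).2 (by omega)
  refine ⟨sig S i, h1.1, ?_, ?_⟩
  · unfold f1
    rw [Equiv.trans_apply, rho_fix _ _ _ h1.1]
    rfl
  · intro i' h2 h3 hpar
    have h4 := rho_window t m (fun i => ω.2 (Sum.inl (ω.1 i))) hb i' h2 h3
    unfold f1 at hpar
    rw [Equiv.trans_apply, Equiv.trans_apply, rho_fix _ _ _ h1.1] at hpar
    obtain ⟨a, ha⟩ := (exists_match inc par D hD ω.1).choose_spec _ (sig S i) h1.1 hpar
      (fun j' hj' hp => hc _ h4.1 (sig S i) j' h1.1 hj' hpar hp)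
    apply h1.2
    refine ⟨a, ?_⟩
    change ω.2 (mat inc par D hD ω.1 (Sum.inr (sig S i, a))) = 0
    unfold mat
    rw [ha]
    exact h4.1

end

/-! ### Probability estimates -/

section
variable {E V : Type} [Fintype E] [Fintype V] {M : ℕ}

lemma ord_nonempty (hM : Fintype.card E = M) : Nonempty (Fin M ≃ E) :=
  ⟨(Fintype.equivFinOfCardEq hM).symm⟩

lemma sum_ind {ι : Type} (B : Finset ι) (p : ι → Prop) [DecidablePred p] :
    ∑ x ∈ B, ind (p x) = ((B.filter p).card : ℝ) := by
  rw [Finset.card_filter]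
  push_cast
  apply Finset.sum_congr rfl
  intro x _
  unfold ind
  congr

lemma sum_ind_eq {ι : Type} [Fintype ι] (b : ι) : ∑ a : ι, ind (b = a) = 1 := by
  rw [sum_ind, Finset.filter_eq]
  simp

/-- Probability of avoiding `a` elements on `b` positions. -/
def Q (M a b : ℕ) : ℝ := ∏ i ∈ Finset.range b, (1 - (a : ℝ) / ((M : ℝ) - i))

lemma sum_ind_card (A : Finset E) (B : Finset (Fin M)) (f : Fin M ≃ E) :
    ∑ j ∈ Bᶜ, ind ((∀ i ∈ B, f i ∉ A) ∧ f j ∈ A) = (A.card : ℝ) * ind (∀ i ∈ B, f i ∉ A) := by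
  by_cases h : ∀ i ∈ B, f i ∉ A
  · rw [ind_true h, mul_one]
    have h1 : ∀ j ∈ Bᶜ, ind ((∀ i ∈ B, f i ∉ A) ∧ f j ∈ A) = ind (f j ∈ A) := by
      intro j _
      congr 1
      exact propext ⟨fun hh => hh.2, fun hh => ⟨h, hh⟩⟩
    rw [Finset.sum_congr rfl h1, sum_ind]
    congr 1
    rw [← Finset.card_map f.toEmbedding]
    congr 1
    ext x
    simp only [Finset.mem_map_equiv, Finset.mem_filter, Finset.mem_compl, Equiv.apply_symm_apply]
    constructor
    · exact fun hx => hx.2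
    · intro hx
      exact ⟨fun hb => h _ hb (by simpa using hx), hx⟩
  · rw [ind_false h, mul_zero]
    apply Finset.sum_eq_zero
    intro j _
    exact ind_false fun hh => h hh.1

lemma avoid_eq (hM : Fintype.card E = M) (A : Finset E) (B : Finset (Fin M)) :
    Ex (fun f : Fin M ≃ E => ind (∀ i ∈ B, f i ∉ A)) = Q M A.card B.card := by
  have := ord_nonempty hM
  induction B using Finset.induction_on with
  | empty =>
    have : (fun f : Fin M ≃ E => ind (∀ i ∈ (∅ : Finset (Fin M)), f i ∉ A)) = fun _ => 1 := by
      funext f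
      exact ind_true (by simp)
    rw [this, Ex_const]
    simp [Q]
  | insert j B hj ih =>
    set y : Fin M → ℝ := fun j' => Ex (fun f : Fin M ≃ E => ind ((∀ i ∈ B, f i ∉ A) ∧ f j' ∈ A)) with hy
    have hsym : ∀ j' ∈ Bᶜ, y j' = y j := by
      intro j' hj'
      rw [Finset.mem_compl] at hj'
      let e : (Fin M ≃ E) ≃ (Fin M ≃ E) := Equiv.equivCongr (Equiv.swap j j') (Equiv.refl E)
      rw [hy]
      dsimp only
      rw [← Ex_equiv e]
      congr 1
      funext f
      congr 1
      have he : ∀ i, e f i = f (Equiv.swap j j' i) := by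
        intro i
        simp [e, Equiv.equivCongr]
      simp only [he, Equiv.swap_apply_right]
      apply propext
      refine and_congr_left fun _ => forall_congr' fun i => forall_congr' fun hi => ?_
      rw [Equiv.swap_apply_of_ne_of_ne (by rintro rfl; exact hj hi) (by rintro rfl; exact hj' hi)]
    have hlt : B.card < M := by
      have := Finset.card_lt_univ_of_notMem hj
      simpa using this
    have hsum : ((M : ℝ) - B.card) * y j = A.card * Q M A.card B.card := by
      rw [← ih, ← Ex_mul (A.card : ℝ), ← funext fun f => sum_ind_card A B f, Ex_sum, Finset.sum_congr rfl hsym,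
        Finset.sum_const, nsmul_eq_mul, Finset.card_compl, Fintype.card_fin, Nat.cast_sub hlt.le]
    have hpos : (0 : ℝ) < (M : ℝ) - B.card := by
      have : (B.card : ℝ) < M := by exact_mod_cast hlt
      linarith
    have hy2 : y j = A.card * Q M A.card B.card / ((M : ℝ) - B.card) := by
      rw [eq_div_iff hpos.ne', mul_comm, hsum]
    have hsplit : Ex (fun f : Fin M ≃ E => ind (∀ i ∈ insert j B, f i ∉ A)) =
        Ex (fun f : Fin M ≃ E => ind (∀ i ∈ B, f i ∉ A)) - y j := by
      rw [hy]
      dsimp only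
      rw [← Ex_sub]
      congr 1
      funext f
      by_cases h1 : ∀ i ∈ B, f i ∉ A
      · by_cases h2 : f j ∈ A
        · rw [ind_false (fun h => h j (Finset.mem_insert_self _ _) h2), ind_true h1, ind_true ⟨h1, h2⟩]
          ring
        · rw [ind_true h1, ind_false (p := (∀ i ∈ B, f i ∉ A) ∧ f j ∈ A) (fun h => h2 h.2), ind_true]
          · ring
          · intro i hi
            rcases Finset.mem_insert.1 hi with rfl | hi
            · exact h2
            · exact h1 i hi
      · rw [ind_false h1, ind_false (p := (∀ i ∈ B, f i ∉ A) ∧ f j ∈ A) (fun h => h1 h.1), ind_false]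
        · ring
        · exact fun h => h1 fun i hi => h i (Finset.mem_insert_of_mem hi)
    rw [hsplit, ih, hy2, Finset.card_insert_of_notMem hj]
    unfold Q
    rw [Finset.prod_range_succ]
    ring

lemma Q_nonneg_of (hM : Fintype.card E = M) (A : Finset E) (b : ℕ) (hb : b ≤ M) :
    0 ≤ Q M A.card b := by
  rw [← card_lt hb, ← avoid_eq hM]
  exact Ex_nonneg fun f => ind_nonneg _

lemma Q_succ (M a b : ℕ) : Q M a (b + 1) = (1 - (a : ℝ) / ((M : ℝ) - b)) * Q M a b := by
  unfold Q
  rw [Finset.prod_range_succ, mul_comm]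

lemma Q_upper (hM : Fintype.card E = M) (A : Finset E) (b : ℕ) (hb : b ≤ M) :
    Q M A.card b ≤ (1 - (A.card : ℝ) / M) ^ b := by
  have hA : A.card ≤ M := hM ▸ Finset.card_le_univ A
  induction b with
  | zero => simp [Q]
  | succ b ih =>
    rw [Q_succ, pow_succ']
    have hbM : (b : ℝ) + 1 ≤ M := by exact_mod_cast hb
    have h0 := Q_nonneg_of hM A b (by omega)
    have h1 := ih (by omega)
    have hb0 : (0 : ℝ) ≤ b := Nat.cast_nonneg b
    have h2 : (A.card : ℝ) / M ≤ (A.card : ℝ) / ((M : ℝ) - b) := by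
      apply div_le_div_of_nonneg_left (Nat.cast_nonneg _) <;> linarith
    have h3 : 0 ≤ 1 - (A.card : ℝ) / M := by
      rw [sub_nonneg, div_le_one (by linarith)]
      exact_mod_cast hA
    calc _ ≤ (1 - (A.card : ℝ) / M) * Q M A.card b := by
          apply mul_le_mul_of_nonneg_right _ h0
          linarith
      _ ≤ _ := mul_le_mul_of_nonneg_left h1 h3

lemma Q_lower (M a t : ℕ) (ht : a + t ≤ M) (htM : t < M) (b : ℕ) (hb : b ≤ t) :
    (1 - (a : ℝ) / ((M : ℝ) - t)) ^ b ≤ Q M a b := by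
  have h4 : (t : ℝ) < M := by exact_mod_cast htM
  have h5 : (a : ℝ) + t ≤ M := by exact_mod_cast ht
  have h3 : 0 ≤ 1 - (a : ℝ) / ((M : ℝ) - t) := by
    rw [sub_nonneg, div_le_one (by linarith)]
    linarith
  induction b with
  | zero => simp [Q]
  | succ b ih =>
    rw [Q_succ, pow_succ']
    have hbM : (b : ℝ) + 1 ≤ t := by exact_mod_cast hb
    have h1 := ih (by omega)
    have h2 : (a : ℝ) / ((M : ℝ) - b) ≤ (a : ℝ) / ((M : ℝ) - t) := by
      apply div_le_div_of_nonneg_left (Nat.cast_nonneg _) <;> linarith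
    apply mul_le_mul _ h1 (pow_nonneg h3 _)
    · linarith
    · linarith

lemma Q_neg (hM : Fintype.card E = M) (A B : Finset E) (d d2 : ℕ) (hA : A.card = d) (hB : B.card = d)
    (hAB : (A ∩ B).card = d2) (hdd : d2 * M ≤ d * d) (b : ℕ) (hb : b ≤ M) :
    Q M (A ∪ B).card b ≤ Q M d b * Q M d b := by
  have hun : ((A ∪ B).card : ℝ) = 2 * d - d2 := by
    have := Finset.card_union_add_card_inter A B
    rw [hA, hB, hAB] at this
    have : ((A ∪ B).card : ℝ) + d2 = d + d := by exact_mod_cast this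
    linarith
  have hdd' : (d2 : ℝ) * M ≤ d * d := by exact_mod_cast hdd
  induction b with
  | zero => simp [Q]
  | succ b ih =>
    have h0 := Q_nonneg_of hM (A ∪ B) b (by omega)
    have h1 := ih (by omega)
    rw [Q_succ, Q_succ]
    have hbM : (b : ℝ) + 1 ≤ M := by exact_mod_cast hb
    have hb0 : (0 : ℝ) ≤ b := Nat.cast_nonneg b
    have hd0 : (0 : ℝ) ≤ d2 := Nat.cast_nonneg d2
    have hN : (0 : ℝ) < (M : ℝ) - b := by linarith
    have h2 : 1 - ((A ∪ B).card : ℝ) / ((M : ℝ) - b) ≤ (1 - (d : ℝ) / ((M : ℝ) - b)) ^ 2 := by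
      rw [hun]
      have : (d2 : ℝ) / ((M : ℝ) - b) ≤ ((d : ℝ) / ((M : ℝ) - b)) ^ 2 := by
        rw [div_pow, div_le_div_iff₀ hN (by positivity)]
        have : (d2 : ℝ) * ((M : ℝ) - b) ≤ d * d := by nlinarith
        nlinarith
      have e1 : (2 * (d : ℝ) - d2) / ((M : ℝ) - b) = 2 * ((d : ℝ) / ((M : ℝ) - b)) - d2 / ((M : ℝ) - b) := by
        ring
      rw [e1]
      nlinarith
    calc _ ≤ (1 - (d : ℝ) / ((M : ℝ) - b)) ^ 2 * Q M (A ∪ B).card b := mul_le_mul_of_nonneg_right h2 h0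
      _ ≤ (1 - (d : ℝ) / ((M : ℝ) - b)) ^ 2 * (Q M d b * Q M d b) :=
          mul_le_mul_of_nonneg_left h1 (by positivity)
      _ = _ := by ring

/-- edges through `v` -/
def thr (inc : E → Finset V) (v : V) : Finset E := Finset.univ.filter (fun h => v ∈ inc h)

def first (M t : ℕ) : Finset (Fin M) := Finset.univ.filter (fun i : Fin M => (i : ℕ) < t)

lemma mem_first {M t : ℕ} {i : Fin M} : i ∈ first M t ↔ (i : ℕ) < t := by simp [first]

lemma card_first {M t : ℕ} (h : t ≤ M) : (first M t).card = t := card_lt h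

/-- First-moment upper bound on `T`. -/
lemma prob_not_cov (hM : Fintype.card E = M) (inc : E → Finset V) (d : ℕ)
    (hd : ∀ v, (thr inc v).card = d) (t : ℕ) (ht : t ≤ M) :
    Ex (fun f : Fin M ≃ E => ind (¬ Cov inc f t)) ≤ Fintype.card V * (1 - (d : ℝ) / M) ^ t := by
  calc _ ≤ Ex (fun f : Fin M ≃ E => ∑ v ∈ (Finset.univ : Finset V), ind (∀ i ∈ first M t, f i ∉ thr inc v)) := by
        apply Ex_mono
        intro f
        apply ind_exists
        intro h
        unfold Cov at h
        push Not at h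
        obtain ⟨v, hv⟩ := h
        refine ⟨v, Finset.mem_univ _, fun i hi => ?_⟩
        simpa [thr] using hv i (mem_first.1 hi)
    _ = ∑ v ∈ (Finset.univ : Finset V), Q M d t := by
        rw [Ex_sum]
        apply Finset.sum_congr rfl
        intro v _
        rw [avoid_eq hM, hd, card_first ht]
    _ ≤ ∑ v ∈ (Finset.univ : Finset V), (1 - (d : ℝ) / M) ^ t := by
        apply Finset.sum_le_sum
        intro v _
        rw [← hd v]
        exact Q_upper hM _ t ht
    _ = _ := by simp

/-- Second moment: with high probability there is an isolated vertex at time `t`. -/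
lemma prob_cov (hM : Fintype.card E = M) (inc : E → Finset V) (d d2 : ℕ)
    (hd : ∀ v, (thr inc v).card = d) (hd2 : ∀ v w, v ≠ w → (thr inc v ∩ thr inc w).card = d2)
    (hdd : d2 * M ≤ d * d) (t : ℕ) (ht : t ≤ M) (hpos : 0 < (Fintype.card V : ℝ) * Q M d t) :
    Ex (fun f : Fin M ≃ E => ind (Cov inc f t)) ≤ 1 / (Fintype.card V * Q M d t) := by
  have := ord_nonempty hM
  set I : V → (Fin M ≃ E) → ℝ := fun v f => ind (∀ i ∈ first M t, f i ∉ thr inc v) with hI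
  set m : ℝ := Fintype.card V * Q M d t with hm
  have hIe : ∀ v, Ex (I v) = Q M d t := by
    intro v
    rw [hI]
    dsimp only
    rw [avoid_eq hM, hd, card_first ht]
  have hIJ : ∀ v w, v ≠ w → Ex (fun f => I v f * I w f) ≤ Q M d t * Q M d t := by
    intro v w hvw
    have h1 : (fun f => I v f * I w f) = fun f : Fin M ≃ E => ind (∀ i ∈ first M t, f i ∉ thr inc v ∪ thr inc w) := by
      funext f
      rw [hI]
      dsimp only
      by_cases h1 : ∀ i ∈ first M t, f i ∉ thr inc v
      · by_cases h2 : ∀ i ∈ first M t, f i ∉ thr inc w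
        · rw [ind_true h1, ind_true h2, ind_true]
          · ring
          · intro i hi
            rw [Finset.mem_union]
            push Not
            exact ⟨h1 i hi, h2 i hi⟩
        · rw [ind_false h2, ind_false (p := ∀ i ∈ first M t, f i ∉ thr inc v ∪ thr inc w), mul_zero]
          exact fun h => h2 fun i hi hh => h i hi (Finset.mem_union_right _ hh)
      · rw [ind_false h1, ind_false (p := ∀ i ∈ first M t, f i ∉ thr inc v ∪ thr inc w), zero_mul]
        exact fun h => h1 fun i hi hh => h i hi (Finset.mem_union_left _ hh)
    rw [h1, avoid_eq hM, card_first ht]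
    exact Q_neg hM _ _ d d2 (hd v) (hd w) (hd2 v w hvw) hdd t ht
  have hII : ∀ v, Ex (fun f => I v f * I v f) = Q M d t := by
    intro v
    rw [← hIe v]
    congr 1
    funext f
    rw [hI]
    dsimp only
    unfold ind
    split_ifs <;> norm_num
  set X : (Fin M ≃ E) → ℝ := fun f => ∑ v, I v f with hX
  have hEX : Ex X = m := by
    rw [hX, Ex_sum]
    simp only [hIe, Finset.sum_const, nsmul_eq_mul, hm, Finset.card_univ]
  have hEX2 : Ex (fun f => X f * X f) ≤ m + m * m := by
    have h1 : (fun f => X f * X f) = fun f => ∑ v, ∑ w, I v f * I w f := by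
      funext f
      rw [hX]
      dsimp only
      rw [Finset.sum_mul_sum]
    rw [h1, Ex_sum]
    simp only [Ex_sum]
    have h2 : ∀ v w, Ex (fun f => I v f * I w f) ≤ (if v = w then Q M d t else 0) + Q M d t * Q M d t := by
      intro v w
      by_cases h : v = w
      · subst h
        rw [hII, if_pos rfl]
        nlinarith [mul_self_nonneg (Q M d t)]
      · rw [if_neg h, zero_add]
        exact hIJ v w h
    calc _ ≤ ∑ v : V, ∑ w : V, ((if v = w then Q M d t else 0) + Q M d t * Q M d t) :=
          Finset.sum_le_sum fun v _ => Finset.sum_le_sum fun w _ => h2 v w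
      _ = m + m * m := by
        simp only [Finset.sum_add_distrib, Finset.sum_ite_eq, Finset.mem_univ, if_true, Finset.sum_const,
          nsmul_eq_mul, Finset.card_univ, hm]
        ring
  have hcheb : m * m * Ex (fun f : Fin M ≃ E => ind (Cov inc f t)) ≤ m := by
    calc _ ≤ Ex (fun f => X f * X f - 2 * m * X f + m * m) := by
          rw [← Ex_mul]
          apply Ex_mono
          intro f
          by_cases h : Cov inc f t
          · have : X f = 0 := by
              rw [hX]
              apply Finset.sum_eq_zero
              intro v _
              apply ind_false
              intro hh
              obtain ⟨i, hi, hv⟩ := h v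
              exact hh i (mem_first.2 hi) (by simpa [thr] using hv)
            rw [this, ind_true h]
            linarith
          · rw [ind_false h]
            nlinarith [sq_nonneg (X f - m)]
      _ = Ex (fun f => X f * X f) - 2 * m * m + m * m := by
          rw [Ex_add (fun f => X f * X f - 2 * m * X f) (fun _ => m * m), Ex_const,
            Ex_sub (fun f => X f * X f), Ex_mul, hEX]
      _ ≤ m := by linarith
  rw [le_div_iff₀ hpos]
  nlinarith

/-- Probability of degree at most one. -/
lemma prob_deg (hM : Fintype.card E = M) (inc : E → Finset V) (d : ℕ)
    (hd : ∀ v, (thr inc v).card = d) (b : ℕ) (hb : 2 * b ≤ M) (v : V) :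
    Ex (fun f : Fin M ≃ E => ind (∀ i i' : Fin M, (i : ℕ) < 2 * b → (i' : ℕ) < 2 * b →
      v ∈ inc (f i) → v ∈ inc (f i') → i = i')) ≤ 2 * (1 - (d : ℝ) / M) ^ b := by
  set B2 : Finset (Fin M) := first M (2 * b) \ first M b with hB2
  have hB2c : B2.card = b := by
    rw [hB2, Finset.card_sdiff_of_subset, card_first (by omega), card_first (by omega)]
    · omega
    · intro i hi
      rw [mem_first] at hi ⊢
      omega
  calc _ ≤ Ex (fun f : Fin M ≃ E => ind (∀ i ∈ first M b, f i ∉ thr inc v) + ind (∀ i ∈ B2, f i ∉ thr inc v)) := by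
        apply Ex_mono
        intro f
        apply ind_or
        intro h
        by_contra hcon
        push Not at hcon
        obtain ⟨⟨i, hi, hiv⟩, ⟨i', hi', hiv'⟩⟩ := hcon
        rw [hB2, Finset.mem_sdiff, mem_first, mem_first] at hi'
        rw [mem_first] at hi
        simp only [thr, Finset.mem_filter, Finset.mem_univ, true_and] at hiv hiv'
        have := h i i' (by omega) (by omega) hiv hiv'
        subst this
        omega
    _ = Q M d b + Q M d b := by
        rw [Ex_add, avoid_eq hM, avoid_eq hM, hd, hB2c, card_first (by omega)]
    _ ≤ _ := by
        have := Q_upper hM (thr inc v) b (by omega)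
        rw [hd] at this
        linarith

/-- Probability that two positions both land in `A`. -/
lemma prob_two (hM : Fintype.card E = M) (A : Finset E) (j j' : Fin M) (hj : j ≠ j') :
    Ex (fun f : Fin M ≃ E => ind (f j ∈ A ∧ f j' ∈ A)) ≤ ((A.card : ℝ) / M) ^ 2 := by
  have := ord_nonempty hM
  have h1 := avoid_eq hM A {j}
  have h2 := avoid_eq hM A {j'}
  have h3 := avoid_eq hM A {j, j'}
  have hc : ({j, j'} : Finset (Fin M)).card = 2 := Finset.card_pair hj
  have h2M : 2 ≤ M := by
    rw [← hc]
    simpa using Finset.card_le_univ ({j, j'} : Finset (Fin M))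
  have hu := Q_upper hM A 2 h2M
  have hQ1 : Q M A.card 1 = 1 - (A.card : ℝ) / M := by simp [Q]
  rw [Finset.card_singleton, hQ1] at h1 h2
  rw [hc] at h3
  have : Ex (fun f : Fin M ≃ E => ind (f j ∈ A ∧ f j' ∈ A)) =
      1 - (1 - (A.card : ℝ) / M) - (1 - (A.card : ℝ) / M) + Q M A.card 2 := by
    rw [← h3]
    nth_rewrite 1 [← h1]
    rw [← h2]
    nth_rewrite 1 [← Ex_const (α := Fin M ≃ E) 1]
    rw [← Ex_sub, ← Ex_sub, ← Ex_add]
    congr 1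
    funext f
    unfold ind
    by_cases a : f j ∈ A <;> by_cases b : f j' ∈ A <;> simp [a, b]
  rw [this]
  nlinarith

/-! colours -/
lemma col_one {X : Type} [Fintype X] [DecidableEq X] (k : ℕ) [NeZero k] (x : X) :
    Ex (fun c : X → Fin k => ind (c x = 0)) = 1 / k := by
  have hsym : ∀ a : Fin k, Ex (fun c : X → Fin k => ind (c x = a)) = Ex (fun c : X → Fin k => ind (c x = 0)) := by
    intro a
    rw [← Ex_equiv (Equiv.addRight (Pi.single x a : X → Fin k)) (fun c => ind (c x = a))]
    congr 1
    funext c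
    simp
  have hsum : ∑ a : Fin k, Ex (fun c : X → Fin k => ind (c x = a)) = 1 := by
    rw [← Ex_sum, ← Ex_const (α := X → Fin k) 1]
    congr 1
    funext c
    exact sum_ind_eq _
  simp only [hsym, Finset.sum_const, nsmul_eq_mul, Finset.card_univ, Fintype.card_fin] at hsum
  have : (k : ℝ) ≠ 0 := by exact_mod_cast NeZero.ne k
  field_simp
  linarith

lemma col_two {X : Type} [Fintype X] [DecidableEq X] (k : ℕ) [NeZero k] (x y : X) (hxy : x ≠ y) :
    Ex (fun c : X → Fin k => ind (c x = 0) * ind (c y = 0)) = (1 / k) * (1 / k) := by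
  have hsym : ∀ a : Fin k, Ex (fun c : X → Fin k => ind (c x = a) * ind (c y = 0)) =
      Ex (fun c : X → Fin k => ind (c x = 0) * ind (c y = 0)) := by
    intro a
    rw [← Ex_equiv (Equiv.addRight (Pi.single x a : X → Fin k)) (fun c => ind (c x = a) * ind (c y = 0))]
    congr 1
    funext c
    simp [Pi.single_eq_of_ne hxy.symm]
  have hsum : ∑ a : Fin k, Ex (fun c : X → Fin k => ind (c x = a) * ind (c y = 0)) = 1 / k := by
    rw [← Ex_sum, ← col_one k y]
    congr 1
    funext c
    rw [← Finset.sum_mul, sum_ind_eq, one_mul]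
  simp only [hsym, Finset.sum_const, nsmul_eq_mul, Finset.card_univ, Fintype.card_fin] at hsum
  have : (k : ℝ) ≠ 0 := by exact_mod_cast NeZero.ne k
  field_simp
  field_simp at hsum
  linarith

/-- Chebyshev for colours. -/
lemma col_cheb {X : Type} [Fintype X] [DecidableEq X] (k : ℕ) [NeZero k] (B : Finset X) (m : ℕ) (hm : 0 < m)
    (hB : 2 * (m : ℝ) ≤ (B.card : ℝ) / k) :
    Ex (fun c : X → Fin k => ind ((B.filter (fun x => c x = 0)).card < m)) ≤ 2 / m := by
  set μ : ℝ := (B.card : ℝ) / k with hμ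
  have hm' : (0 : ℝ) < m := by exact_mod_cast hm
  have hμ0 : 0 < μ := by linarith
  set Y : (X → Fin k) → ℝ := fun c => ∑ x ∈ B, ind (c x = 0) with hY
  have hYc : ∀ c, Y c = ((B.filter (fun x => c x = 0)).card : ℝ) := by
    intro c
    exact sum_ind B _
  have hEY : Ex Y = μ := by
    rw [hY, Ex_sum]
    simp only [col_one, Finset.sum_const, nsmul_eq_mul, hμ]
    ring
  have hEY2 : Ex (fun c => Y c * Y c) ≤ μ + μ * μ := by
    have h1 : (fun c => Y c * Y c) = fun c : X → Fin k => ∑ x ∈ B, ∑ y ∈ B, ind (c x = 0) * ind (c y = 0) := by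
      funext c
      rw [hY]
      dsimp only
      rw [Finset.sum_mul_sum]
    rw [h1, Ex_sum]
    simp only [Ex_sum]
    have h2 : ∀ x y : X, Ex (fun c : X → Fin k => ind (c x = 0) * ind (c y = 0)) ≤
        (if x = y then 1 / (k : ℝ) else 0) + (1 / k) * (1 / k) := by
      intro x y
      by_cases h : x = y
      · subst h
        rw [if_pos rfl, ← col_one k x]
        have : (fun c : X → Fin k => ind (c x = 0) * ind (c x = 0)) = fun c : X → Fin k => ind (c x = 0) := by
          funext c
          unfold ind
          split_ifs <;> norm_num
        rw [this]
        nlinarith [mul_self_nonneg (Ex fun c : X → Fin k => ind (c x = 0))]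
      · rw [if_neg h, zero_add, col_two k x y h]
    calc _ ≤ ∑ x ∈ B, ∑ y ∈ B, ((if x = y then 1 / (k : ℝ) else 0) + (1 / k) * (1 / k)) :=
          Finset.sum_le_sum fun x _ => Finset.sum_le_sum fun y _ => h2 x y
      _ = μ + μ * μ := by
        simp only [Finset.sum_add_distrib, Finset.sum_ite_eq, Finset.sum_const, nsmul_eq_mul, hμ]
        rw [Finset.sum_congr rfl (fun x hx => if_pos hx), Finset.sum_const, nsmul_eq_mul]
        ring
  have hcheb : μ * μ / 4 * Ex (fun c : X → Fin k => ind ((B.filter (fun x => c x = 0)).card < m)) ≤ μ := by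
    calc _ ≤ Ex (fun c => Y c * Y c - 2 * μ * Y c + μ * μ) := by
          rw [← Ex_mul]
          apply Ex_mono
          intro c
          by_cases h : (B.filter (fun x => c x = 0)).card < m
          · have : Y c ≤ m := by
              rw [hYc]
              exact_mod_cast h.le
            rw [ind_true h]
            nlinarith
          · rw [ind_false h]
            nlinarith [sq_nonneg (Y c - μ)]
      _ = Ex (fun c => Y c * Y c) - 2 * μ * μ + μ * μ := by
          rw [Ex_add (fun c => Y c * Y c - 2 * μ * Y c) (fun _ => μ * μ), Ex_const,
            Ex_sub (fun c => Y c * Y c), Ex_mul, hEY]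
      _ ≤ μ := by linarith
  rw [le_div_iff₀ hm']
  have h0 := Ex_nonneg (X := fun c : X → Fin k => ind ((B.filter (fun x => c x = 0)).card < m)) (fun c => ind_nonneg _)
  set p := Ex (fun c : X → Fin k => ind ((B.filter (fun x => c x = 0)).card < m)) with hp
  have : μ * p ≤ 4 := by
    by_contra hh
    push Not at hh
    nlinarith
  nlinarith

end

/-! ### Combining the bad events -/

section
variable {E V : Type} [Fintype E] [Fintype V] {M : ℕ}

lemma Ex_zero {α : Type} [Fintype α] {X : α → ℝ} (h : ∀ a, X a = 0) : Ex X = 0 := by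
  unfold Ex
  simp [h]

lemma bnd_b {D k : ℕ} [NeZero k] (f : Fin M ≃ E) (N0 mm : ℕ) (hN : N0 ≤ M) (hmm : 0 < mm)
    (hB : 2 * (mm : ℝ) ≤ ((M : ℝ) - N0) / k) :
    Ex (fun c : (E ⊕ (Fin M × Fin D)) → Fin k => ind ((Finset.univ.filter (fun i : Fin M => N0 ≤ (i : ℕ) ∧
      c (Sum.inl (f i)) = 0)).card < mm)) ≤ 2 / mm := by
  set em : Fin M ↪ (E ⊕ (Fin M × Fin D)) := f.toEmbedding.trans Function.Embedding.inl with hem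
  set B := ((first M N0)ᶜ).map em with hBdef
  have hBc : B.card = M - N0 := by
    rw [hBdef, Finset.card_map, Finset.card_compl, card_first hN, Fintype.card_fin]
  have h := col_cheb k B mm hmm (by rw [hBc, Nat.cast_sub hN]; exact hB)
  refine le_trans (le_of_eq ?_) h
  congr 1
  funext c
  congr 2
  rw [hBdef, Finset.filter_map, Finset.card_map]
  congr 1
  ext i
  simp [mem_first, hem]

lemma bnd_c (hM : Fintype.card E = M) (par : E → E → Prop) (hsym : ∀ a b, par a b → par b a) {D k : ℕ} [NeZero k]
    (hD : ∀ h, (Finset.univ.filter (fun h' => par h h')).card ≤ D) (N0 : ℕ) (hN : N0 ≤ M) :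
    Ex (fun ω : Om E M D k => ind (∃ h', ω.2 (Sum.inl h') = 0 ∧ ∃ j j' : Fin M, (j : ℕ) < N0 ∧ (j' : ℕ) < N0 ∧
      j ≠ j' ∧ par (ω.1 j) h' ∧ par (ω.1 j') h')) ≤ M * (N0 * N0) * ((1 / k) * ((D : ℝ) / M) ^ 2) := by
  have := ord_nonempty hM
  have hk : (0 : ℝ) < k := by exact_mod_cast Nat.pos_of_ne_zero (NeZero.ne k)
  calc _ ≤ Ex (fun ω : Om E M D k => ∑ p ∈ (Finset.univ : Finset E) ×ˢ (first M N0 ×ˢ first M N0),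
        ind (ω.2 (Sum.inl p.1) = 0 ∧ p.2.1 ≠ p.2.2 ∧ par (ω.1 p.2.1) p.1 ∧ par (ω.1 p.2.2) p.1)) := by
        apply Ex_mono
        intro ω
        apply ind_exists
        rintro ⟨h', h0, j, j', hj, hj', hne, hp, hp'⟩
        exact ⟨(h', j, j'), by simp [mem_first, hj, hj'], h0, hne, hp, hp'⟩
    _ ≤ ∑ p ∈ (Finset.univ : Finset E) ×ˢ (first M N0 ×ˢ first M N0), ((1 / k) * ((D : ℝ) / M) ^ 2) := by
        rw [Ex_sum]
        apply Finset.sum_le_sum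
        rintro ⟨h', j, j'⟩ _
        dsimp only
        by_cases hne : j = j'
        · refine le_trans (le_of_eq ?_) (by positivity : (0 : ℝ) ≤ _)
          exact Ex_zero fun ω => ind_false (fun h => h.2.1 hne)
        · rw [Ex_prod]
          have h1 : ∀ f : Fin M ≃ E, Ex (fun c : (E ⊕ (Fin M × Fin D)) → Fin k =>
              ind (c (Sum.inl h') = 0 ∧ j ≠ j' ∧ par (f j) h' ∧ par (f j') h')) =
              (1 / k) * ind (f j ∈ (Finset.univ.filter (fun h => par h' h)) ∧
                f j' ∈ (Finset.univ.filter (fun h => par h' h))) := by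
            intro f
            rw [← col_one k (Sum.inl h' : E ⊕ (Fin M × Fin D)), mul_comm, ← Ex_mul]
            congr 1
            funext c
            by_cases hc : c (Sum.inl h') = 0
            · rw [ind_true hc, mul_one]
              congr 1
              simp only [Finset.mem_filter, Finset.mem_univ, true_and]
              exact propext ⟨fun h => ⟨hsym _ _ h.2.2.1, hsym _ _ h.2.2.2⟩,
                fun h => ⟨hc, hne, hsym _ _ h.1, hsym _ _ h.2⟩⟩
            · rw [ind_false hc, mul_zero, ind_false]
              exact fun h => hc h.1
          simp only [h1]
          rw [Ex_mul]
          apply mul_le_mul_of_nonneg_left _ (by positivity)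
          refine le_trans (prob_two hM _ j j' hne) ?_
          have := hD h'
          gcongr
    _ = _ := by
        rw [Finset.sum_const, nsmul_eq_mul, Finset.card_product, Finset.card_product, card_first hN, Finset.card_univ,
          hM]
        push_cast
        ring

lemma smark_one {D k : ℕ} [NeZero k] (i : Fin M) :
    Ex (fun c : (E ⊕ (Fin M × Fin D)) → Fin k => ind (Smark c i)) ≤ D / k := by
  calc _ ≤ Ex (fun c : (E ⊕ (Fin M × Fin D)) → Fin k => ∑ a ∈ (Finset.univ : Finset (Fin D)),
        ind (c (Sum.inr (i, a)) = 0)) := by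
        apply Ex_mono
        intro c
        apply ind_exists
        rintro ⟨a, ha⟩
        exact ⟨a, Finset.mem_univ _, ha⟩
    _ = _ := by
        rw [Ex_sum]
        simp only [col_one]
        simp
        ring

lemma smark_two {D k : ℕ} [NeZero k] (i i' : Fin M) (hne : i ≠ i') :
    Ex (fun c : (E ⊕ (Fin M × Fin D)) → Fin k => ind (Smark c i ∧ Smark c i')) ≤ ((D : ℝ) / k) ^ 2 := by
  calc _ ≤ Ex (fun c : (E ⊕ (Fin M × Fin D)) → Fin k =>
        ∑ a ∈ (Finset.univ : Finset (Fin D × Fin D)),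
        ind (c (Sum.inr (i, a.1)) = 0 ∧ c (Sum.inr (i', a.2)) = 0)) := by
        apply Ex_mono
        intro c
        apply ind_exists
        rintro ⟨⟨a, ha⟩, ⟨b, hb⟩⟩
        exact ⟨(a, b), Finset.mem_univ _, ha, hb⟩
    _ = ∑ a ∈ (Finset.univ : Finset (Fin D × Fin D)), (1 / (k : ℝ)) * (1 / k) := by
        rw [Ex_sum]
        apply Finset.sum_congr rfl
        rintro ⟨a, b⟩ _
        rw [← col_two k (Sum.inr (i, a) : E ⊕ (Fin M × Fin D)) (Sum.inr (i', b)) (by simp [hne])]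
        congr 1
        funext c
        unfold ind
        by_cases h1 : c (Sum.inr (i, a)) = 0 <;> by_cases h2 : c (Sum.inr (i', b)) = 0 <;> simp [h1, h2]
    _ = _ := by
        simp
        ring

lemma bnd_d1 (inc : E → Finset V) {D k : ℕ} [NeZero k] (f : Fin M ≃ E) (N1 : ℕ) :
    Ex (fun c : (E ⊕ (Fin M × Fin D)) → Fin k => ind (Cov inc f (HT inc f) ∧ N1 ≤ HT inc f ∧
      ∃ v, ∀ i : Fin M, (i : ℕ) < HT inc f → v ∈ inc (f i) → Smark c i)) ≤
    ∑ v : V, (ind (∀ i i' : Fin M, (i : ℕ) < N1 → (i' : ℕ) < N1 →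
      v ∈ inc (f i) → v ∈ inc (f i') → i = i') * ((D : ℝ) / k) + ((D : ℝ) / k) ^ 2) := by
  have hk : (0 : ℝ) < k := by exact_mod_cast Nat.pos_of_ne_zero (NeZero.ne k)
  by_cases hT : Cov inc f (HT inc f) ∧ N1 ≤ HT inc f
  · calc _ ≤ Ex (fun c : (E ⊕ (Fin M × Fin D)) → Fin k => ∑ v : V,
        ind (∀ i : Fin M, (i : ℕ) < HT inc f → v ∈ inc (f i) → Smark c i)) := by
          apply Ex_mono
          intro c
          apply ind_exists
          rintro ⟨_, _, v, hv⟩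
          exact ⟨v, Finset.mem_univ _, hv⟩
      _ ≤ _ := by
          rw [Ex_sum]
          apply Finset.sum_le_sum
          intro v _
          by_cases hdeg : ∀ i i' : Fin M, (i : ℕ) < N1 → (i' : ℕ) < N1 →
              v ∈ inc (f i) → v ∈ inc (f i') → i = i'
          · rw [ind_true hdeg, one_mul]
            obtain ⟨i, hi, hv⟩ := hT.1 v
            have h1 : Ex (fun c : (E ⊕ (Fin M × Fin D)) → Fin k =>
                ind (∀ i : Fin M, (i : ℕ) < HT inc f → v ∈ inc (f i) → Smark c i)) ≤ D / k :=
              le_trans (Ex_mono fun c => ind_mono fun h => h i hi hv) (smark_one i)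
            have : 0 ≤ ((D : ℝ) / k) ^ 2 := by positivity
            linarith
          · rw [ind_false hdeg, zero_mul, zero_add]
            push Not at hdeg
            obtain ⟨i, i', hi, hi', hv, hv', hne⟩ := hdeg
            exact le_trans (Ex_mono fun c => ind_mono fun h => ⟨h i (by omega) hv, h i' (by omega) hv'⟩)
              (smark_two i i' hne)
  · refine le_trans (le_of_eq ?_) (Finset.sum_nonneg fun v _ => ?_)
    · exact Ex_zero fun c => ind_false (fun h => hT ⟨h.1, h.2.1⟩)
    · have := ind_nonneg (∀ i i' : Fin M, (i : ℕ) < N1 → (i' : ℕ) < N1 →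
        v ∈ inc (f i) → v ∈ inc (f i') → i = i')
      positivity

lemma bnd_d (hM : Fintype.card E = M) (inc : E → Finset V) (par : E → E → Prop) {D k : ℕ} [NeZero k]
    (hD : ∀ h, (Finset.univ.filter (fun h' => par h h')).card ≤ D) (d : ℕ)
    (hd : ∀ v, (thr inc v).card = d) (b : ℕ) (hb : 2 * b ≤ M) :
    Ex (fun ω : Om E M D k => ind (Cov inc ω.1 (HT inc ω.1) ∧ 2 * b ≤ HT inc ω.1 ∧
      ∃ v, ∀ i : Fin M, (i : ℕ) < HT inc ω.1 → v ∈ inc (ω.1 i) →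
        Smark (fun x => ω.2 (mat inc par D hD ω.1 x)) i)) ≤
    Fintype.card V * (2 * (1 - (d : ℝ) / M) ^ b * ((D : ℝ) / k) + ((D : ℝ) / k) ^ 2) := by
  have := ord_nonempty hM
  have hk : (0 : ℝ) < k := by exact_mod_cast Nat.pos_of_ne_zero (NeZero.ne k)
  rw [Ex_prod]
  dsimp only
  calc _ ≤ Ex (fun f : Fin M ≃ E => ∑ v : V, (((D : ℝ) / k) * ind (∀ i i' : Fin M, (i : ℕ) < 2 * b → (i' : ℕ) < 2 * b →
      v ∈ inc (f i) → v ∈ inc (f i') → i = i') + ((D : ℝ) / k) ^ 2)) := by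
        apply Ex_mono
        intro f
        have h1 := bnd_d1 inc (D := D) (k := k) f (2 * b)
        rw [← Ex_equiv (Equiv.arrowCongr (mat inc par D hD f).symm (Equiv.refl (Fin k)))] at h1
        refine le_trans (le_of_eq ?_) (h1.trans (le_of_eq ?_))
        · rfl
        · apply Finset.sum_congr rfl
          intro v _
          ring
    _ = ∑ v : V, (((D : ℝ) / k) * Ex (fun f : Fin M ≃ E => ind (∀ i i' : Fin M, (i : ℕ) < 2 * b → (i' : ℕ) < 2 * b →
      v ∈ inc (f i) → v ∈ inc (f i') → i = i')) + ((D : ℝ) / k) ^ 2) := by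
        rw [Ex_sum]
        apply Finset.sum_congr rfl
        intro v _
        rw [Ex_add, Ex_mul, Ex_const]
    _ ≤ ∑ v : V, (((D : ℝ) / k) * (2 * (1 - (d : ℝ) / M) ^ b) + ((D : ℝ) / k) ^ 2) := by
        apply Finset.sum_le_sum
        intro v _
        have := prob_deg hM inc d hd b hb v
        gcongr
    _ = _ := by
        simp
        ring

/-- The good event. -/
def Good (inc : E → Finset V) (par : E → E → Prop) {D k : ℕ} [NeZero k]
    (hD : ∀ h, (Finset.univ.filter (fun h' => par h h')).card ≤ D) (m : ℕ) (ω : Om E M D k) : Prop :=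
  ∀ i : Fin M, (i : ℕ) < HT inc (f2 inc par D k hD ω) →
    ∃ j : Fin M, (j : ℕ) < HT inc (f1 inc D k ω) ∧ f2 inc par D k hD ω i = f1 inc D k ω j ∧
      ∀ i' : Fin M, HT inc (f1 inc D k ω) ≤ (i' : ℕ) → (i' : ℕ) < HT inc (f1 inc D k ω) + m →
        ¬ par (f1 inc D k ω j) (f1 inc D k ω i')

/-- Probability of the bad event. -/
def BadP (inc : E → Finset V) (par : E → E → Prop) {D k : ℕ} [NeZero k]
    (hD : ∀ h, (Finset.univ.filter (fun h' => par h h')).card ≤ D) (m M : ℕ) : ℝ :=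
  Ex (fun ω : Om E M D k => ind (¬ Good inc par hD m ω))

lemma bad_bound (hM : Fintype.card E = M) (inc : E → Finset V) (par : E → E → Prop)
    (hsym : ∀ a b, par a b → par b a) {D k : ℕ} [NeZero k]
    (hD : ∀ h, (Finset.univ.filter (fun h' => par h h')).card ≤ D) (d d2 : ℕ)
    (hd : ∀ v, (thr inc v).card = d) (hd2 : ∀ v w, v ≠ w → (thr inc v ∩ thr inc w).card = d2)
    (hdd : d2 * M ≤ d * d) (N0 b m mm : ℕ) (hN : N0 ≤ M) (hb : 2 * b ≤ M) (hmm : 0 < mm) (hmmm : m ≤ mm)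
    (hB : 2 * (mm : ℝ) ≤ ((M : ℝ) - N0) / k) (hpos : 0 < (Fintype.card V : ℝ) * Q M d (2 * b)) :
    BadP inc par (k := k) hD m M ≤
      Fintype.card V * (1 - (d : ℝ) / M) ^ N0 + 2 / mm + M * (N0 * N0) * ((1 / k) * ((D : ℝ) / M) ^ 2)
      + 1 / (Fintype.card V * Q M d (2 * b))
      + Fintype.card V * (2 * (1 - (d : ℝ) / M) ^ b * ((D : ℝ) / k) + ((D : ℝ) / k) ^ 2) := by
  unfold BadP
  have := ord_nonempty hM
  have hA : Ex (fun ω : Om E M D k => ind (¬ Cov inc ω.1 N0)) ≤ Fintype.card V * (1 - (d : ℝ) / M) ^ N0 := by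
    rw [Ex_fst (fun f : Fin M ≃ E => ind (¬ Cov inc f N0))]
    exact prob_not_cov hM inc d hd N0 hN
  have hE : Ex (fun ω : Om E M D k => ind (Cov inc ω.1 (2 * b))) ≤ 1 / (Fintype.card V * Q M d (2 * b)) := by
    rw [Ex_fst (fun f : Fin M ≃ E => ind (Cov inc f (2 * b)))]
    exact prob_cov hM inc d d2 hd hd2 hdd (2 * b) hb hpos
  have hBb : Ex (fun ω : Om E M D k => ind ((Finset.univ.filter (fun i : Fin M => N0 ≤ (i : ℕ) ∧
      ω.2 (Sum.inl (ω.1 i)) = 0)).card < mm)) ≤ 2 / mm := by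
    rw [Ex_prod, ← Ex_const (α := Fin M ≃ E) (2 / (mm : ℝ))]
    apply Ex_mono
    intro f
    exact bnd_b f N0 mm hN hmm hB
  have hC := bnd_c hM par hsym (k := k) hD N0 hN
  have hDd := bnd_d hM inc par (k := k) hD d hd b hb
  refine le_trans ?_ (add_le_add (add_le_add (add_le_add (add_le_add hA hBb) hC) hE) hDd)
  rw [← Ex_add, ← Ex_add, ← Ex_add, ← Ex_add]
  apply Ex_mono
  intro ω
  by_cases h1 : Cov inc ω.1 N0
  swap
  · rw [ind_true h1]
    have q1 := ind_le_one (¬ Good inc par hD m ω)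
    have q2 := ind_nonneg ((Finset.univ.filter (fun i : Fin M => N0 ≤ (i : ℕ) ∧
      ω.2 (Sum.inl (ω.1 i)) = 0)).card < mm)
    have q3 := ind_nonneg (∃ h', ω.2 (Sum.inl h') = 0 ∧ ∃ j j' : Fin M, (j : ℕ) < N0 ∧ (j' : ℕ) < N0 ∧
      j ≠ j' ∧ par (ω.1 j) h' ∧ par (ω.1 j') h')
    have q4 := ind_nonneg (Cov inc ω.1 (2 * b))
    have q5 := ind_nonneg (Cov inc ω.1 (HT inc ω.1) ∧ 2 * b ≤ HT inc ω.1 ∧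
      ∃ v, ∀ i : Fin M, (i : ℕ) < HT inc ω.1 → v ∈ inc (ω.1 i) →
        Smark (fun x => ω.2 (mat inc par D hD ω.1 x)) i)
    linarith
  have hcov := HT_cov h1
  have hle := HT_le h1
  rw [ind_false (not_not.2 h1), zero_add]
  refine le_trans (ind_or (s := (Cov inc ω.1 (HT inc ω.1) ∧ 2 * b ≤ HT inc ω.1 ∧
      ∃ v, ∀ i : Fin M, (i : ℕ) < HT inc ω.1 → v ∈ inc (ω.1 i) →
        Smark (fun x => ω.2 (mat inc par D hD ω.1 x)) i))
      (q := (((Finset.univ.filter (fun i : Fin M => N0 ≤ (i : ℕ) ∧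
      ω.2 (Sum.inl (ω.1 i)) = 0)).card < mm) ∨ (∃ h', ω.2 (Sum.inl h') = 0 ∧ ∃ j j' : Fin M, (j : ℕ) < N0 ∧ (j' : ℕ) < N0 ∧
      j ≠ j' ∧ par (ω.1 j) h' ∧ par (ω.1 j') h')) ∨ Cov inc ω.1 (2 * b)) ?_) ?_
  · intro hbad
    by_contra hcon
    push Not at hcon
    obtain ⟨⟨⟨c1, c2⟩, c3⟩, c4⟩ := hcon
    apply hbad
    intro i hi
    apply good_event inc par hD ω m _ _ _ i hi
    · refine hmmm.trans (c1.trans (Finset.card_le_card ?_))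
      intro i
      simp only [Finset.mem_filter, Finset.mem_univ, true_and]
      exact fun h => ⟨by omega, h.2⟩
    · intro h' h0 j j' hj hj' hp hp'
      by_contra hne
      exact c2 h' h0 j j' (by omega) (by omega) (fun h => hne h.symm) hp hp'
    · have h2b : 2 * b ≤ HT inc ω.1 := by
        by_contra hlt
        push Not at hlt
        exact c3 (hcov.mono hlt.le)
      exact c4 hcov h2b
  · exact add_le_add (le_trans (ind_or id) (add_le_add (ind_or id) le_rfl)) le_rfl

end

/-! ### Counting `F`-edges -/

section
variable {r : ℕ} (F : Finset (Finset (Fin r)))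

/-- The type of `F`-edges. -/
abbrev EE (n : ℕ) : Type := {h : FE n // IsFEdge F n h}

/-- Vertex set of an `F`-edge. -/
def vs {n : ℕ} (h : EE F n) : Finset (Fin n) := h.1.1

lemma card_EE (n : ℕ) : Fintype.card (EE F n) = Mnum F n := by
  unfold Mnum allFEdges
  rw [Fintype.card_subtype]

lemma card_vs {n : ℕ} (h : EE F n) : (vs F h).card = r := by
  obtain ⟨φ, h1, _⟩ := h.2
  unfold vs
  rw [h1]
  simp

/-- Action of vertex permutations. -/
def act {n : ℕ} (τ : Equiv.Perm (Fin n)) (h : EE F n) : EE F n :=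
  ⟨(h.1.1.map τ.toEmbedding, h.1.2.image (fun e => e.map τ.toEmbedding)), by
    obtain ⟨φ, h1, h2⟩ := h.2
    refine ⟨φ.trans τ.toEmbedding, ?_, ?_⟩
    · dsimp only
      rw [h1, Finset.map_map]
    · dsimp only
      rw [h2, Finset.image_image]
      congr 1
      funext e
      simp [Finset.map_map]⟩

lemma act_inj {n : ℕ} (τ : Equiv.Perm (Fin n)) : Function.Injective (act F τ) := by
  rintro ⟨⟨a, b⟩, ha⟩ ⟨⟨a', b'⟩, ha'⟩ h
  unfold act at h
  simp only [Subtype.mk.injEq, Prod.mk.injEq] at h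
  obtain ⟨h1, h2⟩ := h
  have h1' := Finset.map_injective _ h1
  have h2' := Finset.image_injective (Finset.map_injective τ.toEmbedding) h2
  subst h1' h2'
  rfl

lemma mem_vs_act {n : ℕ} (τ : Equiv.Perm (Fin n)) (h : EE F n) (v : Fin n) (hv : v ∈ vs F h) :
    τ v ∈ vs F (act F τ h) := by
  unfold vs act
  dsimp only
  rw [Finset.mem_map]
  exact ⟨v, hv, rfl⟩

lemma thr_le {n : ℕ} (v v' : Fin n) : (thr (vs F) v).card ≤ (thr (vs F) v').card := by
  apply Finset.card_le_card_of_injOn (act F (Equiv.swap v v'))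
  · intro h hh
    simp only [thr, Finset.coe_filter, Finset.mem_univ, true_and, Set.mem_ofPred_eq] at hh ⊢
    have := mem_vs_act F (Equiv.swap v v') h v hh
    rwa [Equiv.swap_apply_left] at this
  · exact (act_inj F _).injOn

lemma thr2_le {n : ℕ} (v w v' w' : Fin n) (h : v ≠ w) (h' : v' ≠ w') :
    (thr (vs F) v ∩ thr (vs F) w).card ≤ (thr (vs F) v' ∩ thr (vs F) w').card := by
  set τ : Equiv.Perm (Fin n) := Equiv.swap (Equiv.swap v v' w) w' * Equiv.swap v v' with hτ
  have h1 : τ v = v' := by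
    rw [hτ, Equiv.Perm.mul_apply, Equiv.swap_apply_left]
    apply Equiv.swap_apply_of_ne_of_ne
    · intro hh
      apply h
      apply (Equiv.swap v v').injective
      rw [Equiv.swap_apply_left, hh]
      simp [← hh]
    · exact h'
  have h2 : τ w = w' := by
    rw [hτ, Equiv.Perm.mul_apply, Equiv.swap_apply_left]
  apply Finset.card_le_card_of_injOn (act F τ)
  · intro e hh
    rw [Finset.mem_coe, Finset.mem_inter] at hh ⊢
    simp only [thr, Finset.mem_filter, Finset.mem_univ, true_and] at hh ⊢
    have a1 := mem_vs_act F τ e v hh.1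
    have a2 := mem_vs_act F τ e w hh.2
    rw [h1] at a1
    rw [h2] at a2
    exact ⟨a1, a2⟩
  · exact (act_inj F _).injOn

lemma counts (n : ℕ) (hn : 2 ≤ n) (hrn : r ≤ n) (hr : 1 ≤ r) : ∃ d d2 : ℕ, (∀ v, (thr (vs F (n := n)) v).card = d) ∧
    (∀ v w, v ≠ w → (thr (vs F (n := n)) v ∩ thr (vs F) w).card = d2) ∧
    n * d = r * Mnum F n ∧ (n - 1) * d2 = (r - 1) * d ∧ d2 * Mnum F n ≤ d * d := by
  set v0 : Fin n := ⟨0, by omega⟩ with hv0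
  set w0 : Fin n := ⟨1, by omega⟩ with hw0
  have hvw0 : v0 ≠ w0 := by simp [hv0, hw0]
  set d := (thr (vs F) v0).card with hd
  set d2 := (thr (vs F) v0 ∩ thr (vs F) w0).card with hd2
  have hdv : ∀ v, (thr (vs F (n := n)) v).card = d := fun v => le_antisymm (thr_le F _ _) (thr_le F _ _)
  have hdv2 : ∀ v w, v ≠ w → (thr (vs F (n := n)) v ∩ thr (vs F) w).card = d2 :=
    fun v w h => le_antisymm (thr2_le F _ _ _ _ h hvw0) (thr2_le F _ _ _ _ hvw0 h)
  have e1 : n * d = r * Mnum F n := by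
    have := Finset.sum_card_bipartiteAbove_eq_sum_card_bipartiteBelow
      (s := (Finset.univ : Finset (Fin n))) (t := (Finset.univ : Finset (EE F n))) (fun v h => v ∈ vs F h)
    unfold Finset.bipartiteAbove Finset.bipartiteBelow at this
    have a1 : ∀ v ∈ (Finset.univ : Finset (Fin n)), (Finset.univ.filter (fun h : EE F n => v ∈ vs F h)).card = d :=
      fun v _ => by
        rw [← hdv v]
        congr 1
        ext h
        simp [thr]
    have a2 : ∀ h ∈ (Finset.univ : Finset (EE F n)), (Finset.univ.filter (fun v : Fin n => v ∈ vs F h)).card = r := by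
      intro h _
      refine Eq.trans ?_ (card_vs F h)
      congr 1
      ext v
      simp
    rw [Finset.sum_congr rfl a1, Finset.sum_congr rfl a2] at this
    simp only [Finset.sum_const, Finset.card_univ, Fintype.card_fin, smul_eq_mul, card_EE] at this
    rw [this, mul_comm]
  have e2 : (n - 1) * d2 = (r - 1) * d := by
    have := Finset.sum_card_bipartiteAbove_eq_sum_card_bipartiteBelow
      (s := (Finset.univ.erase v0 : Finset (Fin n))) (t := thr (vs F) v0) (fun v h => v ∈ vs F h)
    unfold Finset.bipartiteAbove Finset.bipartiteBelow at this
    have a1 : ∀ v ∈ (Finset.univ.erase v0 : Finset (Fin n)),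
        ((thr (vs F) v0).filter (fun h : EE F n => v ∈ vs F h)).card = d2 := by
      intro v hv
      rw [← hdv2 v0 v (Finset.ne_of_mem_erase hv).symm]
      congr 1
      ext h
      simp [thr]
    have a2 : ∀ h ∈ thr (vs F) v0, ((Finset.univ.erase v0).filter (fun v : Fin n => v ∈ vs F h)).card = r - 1 := by
      intro h hh
      have hv : v0 ∈ vs F h := by simpa [thr] using hh
      refine Eq.trans ?_ (congrArg (fun x => x - 1) (card_vs F h))
      rw [← Finset.card_erase_of_mem hv]
      congr 1
      ext v
      simp
    rw [Finset.sum_congr rfl a1, Finset.sum_congr rfl a2] at this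
    simp only [Finset.sum_const, smul_eq_mul, Finset.card_erase_of_mem (Finset.mem_univ _), Finset.card_univ,
      Fintype.card_fin] at this
    rw [this, mul_comm]
  refine ⟨d, d2, hdv, hdv2, e1, e2, ?_⟩
  obtain ⟨n', rfl⟩ : ∃ n', n = n' + 1 := ⟨n - 1, by omega⟩
  obtain ⟨r', rfl⟩ : ∃ r', r = r' + 1 := ⟨r - 1, by omega⟩
  simp only [Nat.add_sub_cancel] at e2
  have hn' : 0 < n' := by omega
  have hle : r' ≤ n' := by omega
  have key : (n' * (n' + 1)) * (d2 * Mnum F (n' + 1)) ≤ (n' * (n' + 1)) * (d * d) := by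
    calc (n' * (n' + 1)) * (d2 * Mnum F (n' + 1)) = (n' * d2) * ((n' + 1) * Mnum F (n' + 1)) := by ring
      _ = (r' * (n' + 1)) * (d * Mnum F (n' + 1)) := by rw [e2]; ring
      _ ≤ ((r' + 1) * n') * (d * Mnum F (n' + 1)) := by
          apply Nat.mul_le_mul_right
          nlinarith
      _ = n' * d * ((r' + 1) * Mnum F (n' + 1)) := by ring
      _ = _ := by rw [← e1]; ring
  exact Nat.le_of_mul_le_mul_left key (by positivity)

lemma partner_card (u : ℕ) (hu : 2 ≤ u) (n d2 : ℕ)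
    (hd2 : ∀ v w, v ≠ w → (thr (vs F (n := n)) v ∩ thr (vs F) w).card = d2) (h : EE F n) :
    (Finset.univ.filter (fun h' : EE F n => Partner u h.1 h'.1)).card ≤ r * r * d2 := by
  calc _ ≤ ((vs F h).offDiag.biUnion (fun p => thr (vs F) p.1 ∩ thr (vs F) p.2)).card := by
        apply Finset.card_le_card
        intro h' hh'
        simp only [Finset.mem_filter, Finset.mem_univ, true_and] at hh'
        have h1 : 1 < (h.1.1 ∩ h'.1.1).card := by
          rw [hh'.2]
          omega
        obtain ⟨a, ha, b, hb, hab⟩ := Finset.one_lt_card.1 h1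
        rw [Finset.mem_inter] at ha hb
        rw [Finset.mem_biUnion]
        refine ⟨(a, b), by rw [Finset.mem_offDiag]; exact ⟨ha.1, hb.1, hab⟩, ?_⟩
        simp only [thr, Finset.mem_inter, Finset.mem_filter, Finset.mem_univ, true_and]
        exact ⟨ha.2, hb.2⟩
    _ ≤ (vs F h).offDiag.card * d2 := by
        apply Finset.card_biUnion_le_card_mul
        intro p hp
        rw [Finset.mem_offDiag] at hp
        exact (hd2 _ _ hp.2.2).le
    _ ≤ _ := by
        apply Nat.mul_le_mul_right
        rw [Finset.offDiag_card, card_vs]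
        omega

lemma choose_le_M (n : ℕ) : n.choose r ≤ Mnum F n := by
  have h : (Finset.powersetCard r (Finset.univ : Finset (Fin n))) ⊆ (allFEdges F n).image Prod.fst := by
    intro s hs
    rw [Finset.mem_powersetCard] at hs
    set φ : Fin r ↪ Fin n := (s.orderEmbOfFin hs.2).toEmbedding with hφ
    rw [Finset.mem_image]
    refine ⟨(Finset.univ.map φ, F.image (fun e => e.map φ)), ?_, ?_⟩
    · simp only [allFEdges, Finset.mem_filter, Finset.mem_univ, true_and]
      exact ⟨φ, rfl, rfl⟩
    · apply Finset.coe_injective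
      simp [hφ]
  have h2 := (Finset.card_le_card h).trans Finset.card_image_le
  rw [Finset.card_powersetCard, Finset.card_univ, Fintype.card_fin] at h2
  exact h2

lemma M_large (hr : 4 ≤ r) : ∀ᶠ n : ℕ in atTop, (n : ℝ) ^ 2 ≤ Mnum F n := by
  filter_upwards [eventually_ge_atTop (2 * r), eventually_ge_atTop (16 * r.factorial)] with n h1 h2
  have h3 := Nat.pow_le_choose (α := ℝ) r n
  have h4 : (n : ℝ) / 2 ≤ ((n + 1 - r : ℕ) : ℝ) := by
    rw [Nat.cast_sub (by omega)]
    push_cast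
    have : (2 : ℝ) * r ≤ n := by exact_mod_cast h1
    linarith
  have hn : (2 : ℝ) ≤ n := by exact_mod_cast (by omega : 2 ≤ n)
  have hfac : (0 : ℝ) < r.factorial := by exact_mod_cast Nat.factorial_pos r
  have h2' : (16 : ℝ) * r.factorial ≤ n := by exact_mod_cast h2
  have h5 : ((n : ℝ) / 2) ^ 4 ≤ ((n + 1 - r : ℕ) : ℝ) ^ r :=
    calc ((n : ℝ) / 2) ^ 4 ≤ ((n : ℝ) / 2) ^ r := pow_le_pow_right₀ (by linarith) hr
      _ ≤ _ := by gcongr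
  have h6 : (n.choose r : ℝ) ≤ Mnum F n := by exact_mod_cast choose_le_M F n
  refine le_trans ?_ h6
  refine le_trans ?_ h3
  rw [le_div_iff₀ hfac]
  refine le_trans ?_ h5
  have : (n : ℝ) ^ 2 * r.factorial ≤ n ^ 2 * (n / 16) := by gcongr; linarith
  refine le_trans this ?_
  have : (n : ℝ) ^ 3 ≤ n ^ 4 := pow_le_pow_right₀ (by linarith) (by norm_num)
  nlinarith

end

/-! ### Asymptotics -/

/-- The number `⌈log n⌉`. -/
def ell (n : ℕ) : ℕ := ⌈Real.log n⌉₊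

/-- The number `⌈log ⌈log n⌉⌉`. -/
def lam (n : ℕ) : ℕ := ⌈Real.log (ell n)⌉₊

lemma log_le_ell (n : ℕ) : Real.log n ≤ ell n := Nat.le_ceil _

lemma log_nat_tendsto : Tendsto (fun n : ℕ => Real.log n) atTop atTop :=
  Real.tendsto_log_atTop.comp tendsto_natCast_atTop_atTop

lemma ell_tendsto : Tendsto (fun n : ℕ => (ell n : ℝ)) atTop atTop :=
  tendsto_atTop_mono log_le_ell log_nat_tendsto

lemma lim_pow (p : ℕ) : Tendsto (fun n : ℕ => (ell n : ℝ) ^ p / n) atTop (nhds 0) := by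
  have h1 : Tendsto (fun n : ℕ => Real.log n ^ p / (n : ℝ)) atTop (nhds 0) :=
    ((Real.isLittleO_pow_log_id_atTop (n := p)).tendsto_div_nhds_zero).comp tendsto_natCast_atTop_atTop
  have h2 := h1.const_mul ((2 : ℝ) ^ p)
  rw [mul_zero] at h2
  refine tendsto_of_tendsto_of_tendsto_of_le_of_le' tendsto_const_nhds h2 ?_ ?_
  · filter_upwards with n
    positivity
  · filter_upwards [log_nat_tendsto.eventually_ge_atTop 1] with n hn
    rw [← mul_div_assoc, ← mul_pow]
    have : (ell n : ℝ) ≤ 2 * Real.log n := by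
      have := (Nat.ceil_lt_add_one (by linarith : 0 ≤ Real.log n)).le
      unfold ell
      linarith
    gcongr

/-- The error term. -/
def eps (r n : ℕ) : ℝ :=
  1 / n + 2 / (n * ell n) + 8 * (2 * (r : ℝ) ^ 4) ^ 2 * ((ell n : ℝ) ^ 3 / n)
    + Real.exp (8 * r) * ((ell n : ℝ) ^ (8 * r) / n)
    + (16 * (2 * (r : ℝ) ^ 4) * (1 / ell n) + 64 * (2 * (r : ℝ) ^ 4) ^ 2 * ((ell n : ℝ) ^ 2 / n))

lemma eps_tendsto (r : ℕ) : Tendsto (eps r) atTop (nhds 0) := by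
  have hi : Tendsto (fun n : ℕ => 1 / (n : ℝ)) atTop (nhds 0) := tendsto_one_div_atTop_nhds_zero_nat
  have hl : Tendsto (fun n : ℕ => 1 / (ell n : ℝ)) atTop (nhds 0) := by
    simp only [one_div]
    exact tendsto_inv_atTop_zero.comp ell_tendsto
  have h2 : Tendsto (fun n : ℕ => 2 / ((n : ℝ) * ell n)) atTop (nhds 0) := by
    have := (hi.mul hl).const_mul 2
    simp only [mul_zero] at this
    refine this.congr fun n => ?_
    rw [one_div_mul_one_div, mul_one_div]
  have := (((hi.add h2).add ((lim_pow 3).const_mul (8 * (2 * (r : ℝ) ^ 4) ^ 2))).add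
    ((lim_pow (8 * r)).const_mul (Real.exp (8 * r)))).add
    ((hl.const_mul (16 * (2 * (r : ℝ) ^ 4))).add ((lim_pow 2).const_mul (64 * (2 * (r : ℝ) ^ 4) ^ 2)))
  simp only [mul_zero, add_zero] at this
  exact this

lemma pow_exp_le (r n N : ℕ) (hn : r ≤ n) (hn0 : 0 < n) :
    (1 - (r : ℝ) / n) ^ (n * N) ≤ Real.exp (-(r * N)) := by
  have hn' : (0 : ℝ) < n := by exact_mod_cast hn0
  have hrn : (r : ℝ) ≤ n := by exact_mod_cast hn
  have h1 : 1 - (r : ℝ) / n ≤ Real.exp (-(r / n)) := by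
    have := Real.add_one_le_exp (-((r : ℝ) / n))
    linarith
  have h0 : 0 ≤ 1 - (r : ℝ) / n := by
    rw [sub_nonneg, div_le_one hn']
    exact hrn
  refine (pow_le_pow_left₀ h0 h1 _).trans (le_of_eq ?_)
  rw [← Real.exp_nat_mul]
  congr 1
  push_cast
  field_simp

lemma exp_le_one_sub (x : ℝ) (h0 : 0 ≤ x) (h1 : x ≤ 1 / 2) : Real.exp (-(2 * x)) ≤ 1 - x := by
  rw [Real.exp_neg]
  have h2 := Real.add_one_le_exp (2 * x)
  rw [inv_le_comm₀ (Real.exp_pos _) (by linarith)]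
  refine le_trans ?_ h2
  rw [inv_le_iff_one_le_mul₀ (by linarith)]
  nlinarith

lemma lam_le (n : ℕ) (h : 1 ≤ ell n) : lam n ≤ ell n := by
  unfold lam
  apply Nat.ceil_le.2
  have h1 : (1 : ℝ) ≤ ell n := by exact_mod_cast h
  have := Real.log_le_sub_one_of_pos (by linarith : (0 : ℝ) < ell n)
  linarith

set_option maxHeartbeats 1000000 in
lemma num_bound (r n M d d2 : ℕ) (hr : 4 ≤ r) (hMn : (n : ℝ) ^ 2 ≤ M) (hnr : 4 * r ≤ n)
    (hl1 : 1 ≤ ell n) (hln : 8 * ell n ≤ n) (e1 : n * d = r * M) (e2 : (n - 1) * d2 = (r - 1) * d) :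
    ∃ k : ℕ, 0 < k ∧ n * ell n ≤ M ∧ 2 * (n * lam n) ≤ M ∧ 0 < n * ell n ∧
      2 * ((n * ell n : ℕ) : ℝ) ≤ ((M : ℝ) - (n * ell n : ℕ)) / k ∧
      0 < (n : ℝ) * Q M d (2 * (n * lam n)) ∧
      n * (1 - (d : ℝ) / M) ^ (n * ell n) + 2 / ((n * ell n : ℕ) : ℝ)
      + M * (((n * ell n : ℕ) : ℝ) * ((n * ell n : ℕ) : ℝ)) * ((1 / k) * (((r * r * d2 : ℕ) : ℝ) / M) ^ 2)
      + 1 / (n * Q M d (2 * (n * lam n)))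
      + n * (2 * (1 - (d : ℝ) / M) ^ (n * lam n) * (((r * r * d2 : ℕ) : ℝ) / k) + (((r * r * d2 : ℕ) : ℝ) / k) ^ 2)
      ≤ eps r n := by
  set l := ell n with hl
  set b := n * lam n with hb
  have hlam := lam_le n hl1
  have hMN : n ^ 2 ≤ M := by exact_mod_cast hMn
  have hMnl : 8 * (n * l) ≤ M := by nlinarith
  have hn0 : 0 < n := by omega
  have hnl0 : 0 < n * l := Nat.mul_pos hn0 (by omega)
  set k := M / (4 * (n * l)) with hk
  have hk1 : 1 ≤ k := by
    rw [hk, Nat.one_le_div_iff (by omega)]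
    omega
  have hbM : 4 * b ≤ M := by
    have : b ≤ n * l := Nat.mul_le_mul_left _ hlam
    omega
  -- real versions
  have rn : (0 : ℝ) < n := by exact_mod_cast hn0
  have rl : (1 : ℝ) ≤ l := by exact_mod_cast hl1
  have rM : (0 : ℝ) < M := by
    have : 0 < M := by omega
    exact_mod_cast this
  have rk : (0 : ℝ) < k := by exact_mod_cast hk1
  have rMnl : 8 * ((n : ℝ) * l) ≤ M := by exact_mod_cast hMnl
  have rnl : (0 : ℝ) < (n : ℝ) * l := by positivity
  have rhr : (4 : ℝ) ≤ r := by exact_mod_cast hr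
  have rnr : (4 : ℝ) * r ≤ n := by exact_mod_cast hnr
  have re1 : (n : ℝ) * d = r * M := by exact_mod_cast e1
  have re2 : ((n : ℝ) - 1) * d2 = (r - 1) * d := by
    have := congrArg (Nat.cast (R := ℝ)) e2
    push_cast [Nat.cast_sub (by omega : 1 ≤ n), Nat.cast_sub (by omega : 1 ≤ r)] at this
    exact this
  have rdM : (d : ℝ) / M = r / n := by
    rw [div_eq_div_iff rM.ne' rn.ne']
    linarith
  have hkup : (k : ℝ) * (4 * (n * l)) ≤ M := by
    have := Nat.div_mul_le_self M (4 * (n * l))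
    rw [← hk] at this
    exact_mod_cast this
  have hklow : (M : ℝ) ≤ k * (8 * (n * l)) := by
    have h1 := Nat.lt_div_mul_add (a := M) (b := 4 * (n * l)) (by omega)
    rw [← hk] at h1
    have h2 : (M : ℝ) ≤ k * (4 * (n * l)) + 4 * (n * l) := by exact_mod_cast h1.le
    linarith
  have hkinv : 1 / (k : ℝ) ≤ 8 * (n * l) / M := by
    rw [div_le_div_iff₀ rk rM]
    linarith
  set R : ℝ := 2 * (r : ℝ) ^ 4 with hR
  have hR0 : 0 < R := by positivity
  set D := r * r * d2 with hDdef
  have hDM : (D : ℝ) / M ≤ R / n ^ 2 := by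
    rw [div_le_div_iff₀ rM (by positivity), hDdef]
    push_cast
    have h1 : (n : ℝ) / 2 * d2 ≤ r * d := by
      have : (0 : ℝ) ≤ d2 := Nat.cast_nonneg _
      have : (0 : ℝ) ≤ d := Nat.cast_nonneg _
      nlinarith
    have h2 : (n : ℝ) ^ 2 * d2 ≤ 2 * r ^ 2 * M := by
      calc (n : ℝ) ^ 2 * d2 = 2 * n * ((n : ℝ) / 2 * d2) := by ring
        _ ≤ 2 * n * (r * d) := by gcongr
        _ = 2 * r * (n * d) := by ring
        _ = _ := by rw [re1]; ring
    calc (r : ℝ) * r * d2 * (n : ℝ) ^ 2 = (r : ℝ) * r * ((n : ℝ) ^ 2 * d2) := by ring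
      _ ≤ (r : ℝ) * r * (2 * (r : ℝ) ^ 2 * M) := by gcongr
      _ = R * M := by rw [hR]; ring
  have hDk : (D : ℝ) / k ≤ 8 * R * l / n := by
    calc (D : ℝ) / k = (D : ℝ) / M * M * (1 / k) := by field_simp
      _ ≤ R / n ^ 2 * M * (8 * (n * l) / M) := by gcongr
      _ = _ := by field_simp
  have hQ : Real.exp (-(8 * r)) / (l : ℝ) ^ (8 * r) ≤ Q M d (2 * b) := by
    have hdM4 : 4 * d ≤ M := by
      have : n * (4 * d) ≤ n * M := by
        calc n * (4 * d) = 4 * (n * d) := by ring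
          _ = (4 * r) * M := by rw [e1]; ring
          _ ≤ n * M := Nat.mul_le_mul_right _ hnr
      exact Nat.le_of_mul_le_mul_left this hn0
    have hlow := Q_lower M d (2 * b) (by omega) (by omega) (2 * b) le_rfl
    refine le_trans ?_ hlow
    have hb4 : 4 * (b : ℝ) ≤ M := by exact_mod_cast hbM
    have h1 : (d : ℝ) / ((M : ℝ) - (2 * b : ℕ)) ≤ 2 * (r / n) := by
      rw [← rdM]
      push_cast
      calc (d : ℝ) / ((M : ℝ) - 2 * b) ≤ d / (M / 2) := by
            apply div_le_div_of_nonneg_left (Nat.cast_nonneg _) <;> linarith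
        _ = _ := by field_simp
    have h2 : 2 * ((r : ℝ) / n) ≤ 1 / 2 := by
      rw [← mul_div_assoc, div_le_div_iff₀ rn (by norm_num)]
      linarith
    have h3 := exp_le_one_sub (2 * ((r : ℝ) / n)) (by positivity) h2
    have h4 : Real.exp (-(2 * (2 * ((r : ℝ) / n)))) ≤ 1 - (d : ℝ) / ((M : ℝ) - (2 * b : ℕ)) := by linarith
    have h5 := pow_le_pow_left₀ (Real.exp_pos _).le h4 (2 * b)
    refine le_trans ?_ h5
    rw [← Real.exp_nat_mul]
    have hl0 : (0 : ℝ) < l := by linarith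
    have h6 : (l : ℝ) ^ (8 * r) = Real.exp (8 * r * Real.log l) := by
      rw [← Real.rpow_natCast, Real.rpow_def_of_pos hl0]
      congr 1
      push_cast
      ring
    rw [h6, div_eq_mul_inv, ← Real.exp_neg, ← Real.exp_add]
    apply Real.exp_le_exp.2
    have h7 : (lam n : ℝ) ≤ Real.log l + 1 := (Nat.ceil_lt_add_one (Real.log_nonneg rl)).le
    rw [hb]
    push_cast
    have h8 : 2 * ((n : ℝ) * lam n) * -(2 * (2 * ((r : ℝ) / n))) = -(8 * r * lam n) := by
      field_simp
      ring
    rw [h8]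
    nlinarith
  have hQ0 : 0 < Q M d (2 * b) := lt_of_lt_of_le (by positivity) hQ
  refine ⟨k, hk1, by omega, by omega, hnl0, ?_, by positivity, ?_⟩
  · rw [le_div_iff₀ rk]
    push_cast
    have h1 : 2 * ((n : ℝ) * l) * k = (k * (4 * (n * l))) / 2 := by ring
    rw [h1]
    linarith
  rw [rdM]
  have hl0 : (0 : ℝ) < l := by linarith
  unfold eps
  rw [← hl, ← hR]
  have A1 : (n : ℝ) * (1 - (r : ℝ) / n) ^ (n * l) ≤ 1 / n := by
    have h1 := pow_exp_le r n l (by omega) hn0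
    have h2 : Real.exp (-(r * l)) ≤ 1 / (n : ℝ) ^ 2 := by
      have h3 : Real.log n ≤ l := log_le_ell n
      calc Real.exp (-(r * l)) ≤ Real.exp (-(2 * Real.log n)) := by
            apply Real.exp_le_exp.2
            nlinarith
        _ = 1 / (n : ℝ) ^ 2 := by
            rw [Real.exp_neg, two_mul, Real.exp_add, Real.exp_log rn, one_div, sq]
    calc _ ≤ (n : ℝ) * (1 / (n : ℝ) ^ 2) := by
          gcongr
          exact h1.trans h2
      _ = _ := by field_simp
  have A2 : 2 / ((n * l : ℕ) : ℝ) ≤ 2 / ((n : ℝ) * l) := by push_cast; exact le_rfl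
  have A3 : (M : ℝ) * (((n * l : ℕ) : ℝ) * ((n * l : ℕ) : ℝ)) * ((1 / k) * ((D : ℝ) / M) ^ 2) ≤
      8 * R ^ 2 * ((l : ℝ) ^ 3 / n) := by
    push_cast
    calc _ ≤ (M : ℝ) * ((n * l) * (n * l)) * ((8 * (n * l) / M) * (R / n ^ 2) ^ 2) := by gcongr
      _ = _ := by field_simp
  have A4 : 1 / ((n : ℝ) * Q M d (2 * b)) ≤ Real.exp (8 * r) * ((l : ℝ) ^ (8 * r) / n) := by
    calc _ ≤ 1 / ((n : ℝ) * (Real.exp (-(8 * r)) / (l : ℝ) ^ (8 * r))) := by gcongr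
      _ = _ := by
        rw [Real.exp_neg]
        field_simp
  have A5 : (n : ℝ) * (2 * (1 - (r : ℝ) / n) ^ b * ((D : ℝ) / k) + ((D : ℝ) / k) ^ 2) ≤
      16 * R * (1 / l) + 64 * R ^ 2 * ((l : ℝ) ^ 2 / n) := by
    have h1 := pow_exp_le r n (lam n) (by omega) hn0
    rw [← hb] at h1
    have h2 : Real.exp (-(r * lam n)) ≤ 1 / (l : ℝ) ^ 2 := by
      have h3 : Real.log l ≤ lam n := Nat.le_ceil _
      have h4 : 0 ≤ Real.log l := Real.log_nonneg rl
      calc Real.exp (-(r * lam n)) ≤ Real.exp (-(2 * Real.log l)) := by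
            apply Real.exp_le_exp.2
            nlinarith
        _ = 1 / (l : ℝ) ^ 2 := by
            rw [Real.exp_neg, two_mul, Real.exp_add, Real.exp_log hl0, one_div, sq]
    calc _ ≤ (n : ℝ) * (2 * (1 / (l : ℝ) ^ 2) * (8 * R * l / n) + (8 * R * l / n) ^ 2) := by
          gcongr
          exact h1.trans h2
      _ = _ := by
        field_simp
        ring
  linarith

section
variable {r : ℕ} (F : Finset (Finset (Fin r)))

lemma main_bound (u n m : ℕ) (hu : 2 ≤ u) (hr : 4 ≤ r) (hMn : (n : ℝ) ^ 2 ≤ Mnum F n) (hnr : 4 * r ≤ n)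
    (hl1 : 1 ≤ ell n) (hln : 8 * ell n ≤ n) (hm : m ≤ n * ell n) :
    ∃ (D k : ℕ) (_ : NeZero k)
      (hD : ∀ h : EE F n, (Finset.univ.filter (fun h' : EE F n => Partner u h.1 h'.1)).card ≤ D),
      BadP (vs F) (fun h h' => Partner u h.1 h'.1) (k := k) hD m (Mnum F n) ≤ eps r n := by
  obtain ⟨d, d2, hd, hd2, e1, e2, hdd⟩ := counts F n (by omega) (by omega) (by omega)
  obtain ⟨k, hk, c1, c2, c3, c4, c5, c6⟩ := num_bound r n (Mnum F n) d d2 hr hMn hnr hl1 hln e1 e2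
  have hkz : NeZero k := ⟨by omega⟩
  have hD := partner_card F u hu n d2 hd2
  refine ⟨r * r * d2, k, hkz, hD, ?_⟩
  have hbad := bad_bound (card_EE F n) (vs F) (fun h h' => Partner u h.1 h'.1)
    (fun a b h => ⟨h.1.symm, by rw [Finset.inter_comm]; exact h.2⟩) (k := k) hD d d2 hd
    (by
      intro v w h
      convert hd2 v w h) hdd (n * ell n) (n * lam n) m (n * ell n)
    c1 c2 c3 hm c4 (by rw [Fintype.card_fin]; exact c5)
  refine hbad.trans ?_
  rw [Fintype.card_fin]
  exact c6

end

/-! ### The coupling -/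

section
variable {E V : Type} [Fintype E] [Fintype V] {M : ℕ}

lemma unif_meas {Ω : Type} [Fintype Ω] [Nonempty Ω] (S : Set Ω) :
    (PMF.uniformOfFintype Ω).toOuterMeasure S =
      ((Finset.univ.filter (fun ω => ω ∈ S)).card : ℝ≥0∞) / Fintype.card Ω := by
  rw [PMF.toOuterMeasure_uniformOfFintype_apply]
  congr 2
  rw [← Fintype.card_subtype]

lemma unif_good {Ω : Type} [Fintype Ω] [Nonempty Ω] (G : Ω → Prop) :
    ENNReal.ofReal (1 - Ex (fun ω => ind (¬ G ω))) ≤ (PMF.uniformOfFintype Ω).toOuterMeasure {ω | G ω} := by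
  have h1 : 1 - Ex (fun ω => ind (¬ G ω)) = Ex (fun ω => ind (G ω)) := by
    rw [← Ex_const (α := Ω) 1, ← Ex_sub]
    congr 1
    funext ω
    by_cases h : G ω <;> simp [ind, h]
  rw [h1, unif_meas]
  unfold Ex
  rw [sum_ind]
  have hc : (0 : ℝ) < Fintype.card Ω := by exact_mod_cast Fintype.card_pos
  rw [ENNReal.ofReal_div_of_pos hc, ENNReal.ofReal_natCast, ENNReal.ofReal_natCast]
  apply le_of_eq
  congr 3

lemma mu_exists (hM : Fintype.card E = M) (inc : E → Finset V) (par : E → E → Prop) {D k : ℕ} [NeZero k]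
    (hD : ∀ h, (Finset.univ.filter (fun h' => par h h')).card ≤ D) :
    ∃ ν : PMF (Om E M D k),
      (∀ a b, ν.toOuterMeasure {ω | f1 inc D k ω = a} = ν.toOuterMeasure {ω | f1 inc D k ω = b}) ∧
      (∀ a b, ν.toOuterMeasure {ω | f2 inc par D k hD ω = a} = ν.toOuterMeasure {ω | f2 inc par D k hD ω = b}) ∧
      ∀ m, ENNReal.ofReal (1 - BadP inc par (k := k) hD m M) ≤ ν.toOuterMeasure {ω | Good inc par hD m ω} := by
  have := ord_nonempty hM
  refine ⟨PMF.uniformOfFintype _, ?_, ?_, ?_⟩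
  · intro a b
    rw [unif_meas, unif_meas]
    congr 2
    have h1 := f1_fiber inc (D := D) (k := k) hM a
    have h2 := f1_fiber inc (D := D) (k := k) hM b
    convert h1.trans h2.symm <;> exact Iff.rfl
  · intro a b
    rw [unif_meas, unif_meas]
    congr 2
    have h1 := f2_fiber inc par (k := k) hD a
    have h2 := f2_fiber inc par (k := k) hD b
    convert h1.trans h2.symm <;> exact Iff.rfl
  · intro m
    exact unif_good _

end

section
variable {r : ℕ} (F : Finset (Finset (Fin r)))

lemma THit_eq (n : ℕ) (f : Fin (Mnum F n) ≃ EE F n) :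
    THit F n (fun i => (f i).1) = HT (vs F) f := by
  unfold THit HT
  congr 1
  ext t
  simp only [Set.mem_ofPred_eq, proc, Cov, vs, Finset.mem_image, Finset.mem_filter, Finset.mem_univ, true_and]
  refine forall_congr' fun v => ?_
  constructor
  · rintro ⟨h, ⟨i, hi, rfl⟩, hv⟩
    exact ⟨i, hi, hv⟩
  · rintro ⟨i, hi, hv⟩
    exact ⟨_, ⟨i, hi, rfl⟩, hv⟩

lemma valid_coe (n : ℕ) (f : Fin (Mnum F n) ≃ EE F n) : ValidOrdH F n (fun i => (f i).1) := by
  refine ⟨fun i j h => f.injective (Subtype.ext h), fun h hh => ⟨f.symm ⟨h, hh⟩, by simp⟩⟩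

lemma valid_lift (n : ℕ) (a : Fin (Mnum F n) → FE n) (ha : ValidOrdH F n a) :
    ∃ f : Fin (Mnum F n) ≃ EE F n, a = fun i => (f i).1 := by
  choose pos hpos using fun h : EE F n => ha.2 h.1 h.2
  have hinj : Function.Injective pos := by
    intro x y hxy
    apply Subtype.ext
    rw [← hpos x, ← hpos y, hxy]
  have hbij : Function.Bijective pos := by
    rw [Fintype.bijective_iff_injective_and_card]
    exact ⟨hinj, by rw [card_EE, Fintype.card_fin]⟩
  refine ⟨(Equiv.ofBijective pos hbij).symm, ?_⟩
  funext i
  obtain ⟨x, rfl⟩ := hbij.2 i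
  rw [hpos]
  congr 1
  rw [Equiv.eq_symm_apply]
  rfl

lemma coe_inj (n : ℕ) (f f' : Fin (Mnum F n) ≃ EE F n) (h : (fun i => (f i).1) = fun i => (f' i).1) : f = f' := by
  ext1 i
  exact Subtype.ext (congrFun h i)

lemma coupling (u n : ℕ) {D k : ℕ} [NeZero k]
    (hD : ∀ h : EE F n, (Finset.univ.filter (fun h' : EE F n => Partner u h.1 h'.1)).card ≤ D) (m : ℕ) :
    ∃ μ : PMF ((Fin (Mnum F n) → FE n) × (Fin (Mnum F n) → FE n)),
      UniformOn μ Prod.fst (ValidOrdH F n) ∧ UniformOn μ Prod.snd (ValidOrdH F n) ∧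
      ENNReal.ofReal (1 - BadP (vs F) (fun h h' => Partner u h.1 h'.1) (k := k) hD m (Mnum F n)) ≤
        μ.toOuterMeasure {ω | ∀ h ∈ proc ω.2 (THit F n ω.2),
                 h ∈ proc ω.1 (THit F n ω.1) ∧
                 ¬ ∃ h' ∈ proc ω.1 (THit F n ω.1 + m),
                     h' ∉ proc ω.1 (THit F n ω.1) ∧ Partner u h h'} := by
  obtain ⟨ν, h1, h2, h3⟩ := mu_exists (card_EE F n) (vs F) (fun h h' => Partner u h.1 h'.1) (k := k) hD
  set F1 := f1 (M := Mnum F n) (vs F) D k with hF1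
  set F2 := f2 (M := Mnum F n) (vs F) (fun h h' => Partner u h.1 h'.1) D k hD with hF2
  refine ⟨ν.map (fun ω => (fun i => (F1 ω i).1, fun i => (F2 ω i).1)), ⟨?_, ?_⟩, ⟨?_, ?_⟩, ?_⟩
  · rw [PMF.toOuterMeasure_apply_eq_one_iff]
    intro x hx
    rw [PMF.mem_support_map_iff] at hx
    obtain ⟨ω, _, rfl⟩ := hx
    exact valid_coe F n _
  · intro a b ha hb
    obtain ⟨f, rfl⟩ := valid_lift F n a ha
    obtain ⟨f', rfl⟩ := valid_lift F n b hb
    rw [PMF.toOuterMeasure_map_apply, PMF.toOuterMeasure_map_apply]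
    convert h1 f f' using 2
    · ext ω
      exact ⟨fun h => coe_inj F n _ _ h, fun h => by
        change (fun i => (F1 ω i).1) = _
        rw [show F1 ω = f from h]⟩
    · ext ω
      exact ⟨fun h => coe_inj F n _ _ h, fun h => by
        change (fun i => (F1 ω i).1) = _
        rw [show F1 ω = f' from h]⟩
  · rw [PMF.toOuterMeasure_apply_eq_one_iff]
    intro x hx
    rw [PMF.mem_support_map_iff] at hx
    obtain ⟨ω, _, rfl⟩ := hx
    exact valid_coe F n _
  · intro a b ha hb
    obtain ⟨f, rfl⟩ := valid_lift F n a ha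
    obtain ⟨f', rfl⟩ := valid_lift F n b hb
    rw [PMF.toOuterMeasure_map_apply, PMF.toOuterMeasure_map_apply]
    convert h2 f f' using 2
    · ext ω
      exact ⟨fun h => coe_inj F n _ _ h, fun h => by
        change (fun i => (F2 ω i).1) = _
        rw [show F2 ω = f from h]⟩
    · ext ω
      exact ⟨fun h => coe_inj F n _ _ h, fun h => by
        change (fun i => (F2 ω i).1) = _
        rw [show F2 ω = f' from h]⟩
  · refine (h3 m).trans ?_
    rw [PMF.toOuterMeasure_map_apply]
    apply MeasureTheory.OuterMeasure.mono
    intro ω hω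
    change Good _ _ hD m ω at hω
    change ∀ h ∈ proc (fun i => (F2 ω i).1) (THit F n (fun i => (F2 ω i).1)),
                 h ∈ proc (fun i => (F1 ω i).1) (THit F n (fun i => (F1 ω i).1)) ∧
                 ¬ ∃ h' ∈ proc (fun i => (F1 ω i).1) (THit F n (fun i => (F1 ω i).1) + m),
                     h' ∉ proc (fun i => (F1 ω i).1) (THit F n (fun i => (F1 ω i).1)) ∧ Partner u h h'
    rw [THit_eq, THit_eq]
    intro h hh
    simp only [proc, Finset.mem_image, Finset.mem_filter, Finset.mem_univ, true_and] at hh ⊢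
    obtain ⟨i, hi, rfl⟩ := hh
    obtain ⟨j, hj, hij, hw⟩ := hω i hi
    refine ⟨⟨j, hj, ?_⟩, ?_⟩
    · rw [hF2, hij]
    · rintro ⟨h', ⟨i', hi', rfl⟩, hno, hp⟩
      refine hw i' ?_ hi' ?_
      · by_contra hlt
        push Not at hlt
        exact hno ⟨i', hlt, rfl⟩
      · rw [← hij]
        exact hp

lemma ell_small : ∀ᶠ n : ℕ in atTop, 8 * ell n ≤ n := by
  have h := lim_pow 1
  filter_upwards [h.eventually_le_const (by norm_num : (0 : ℝ) < 1 / 8), eventually_gt_atTop 0] with n hn h0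
  have hn0 : (0 : ℝ) < n := by exact_mod_cast h0
  rw [pow_one, div_le_div_iff₀ hn0 (by norm_num)] at hn
  have : (8 : ℝ) * ell n ≤ n := by linarith
  exact_mod_cast this

lemma g_small (g : ℕ → ℝ) (hg : GoodG g) : ∀ᶠ n : ℕ in atTop, ⌊g n * (n : ℝ)⌋₊ ≤ n * ell n := by
  have h1 := hg.2.bound (by norm_num : (0 : ℝ) < 1)
  have h2 := (Real.tendsto_log_atTop.comp log_nat_tendsto).eventually_ge_atTop 1
  filter_upwards [h1, h2, log_nat_tendsto.eventually_ge_atTop 0] with n hn hn2 hn3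
  apply Nat.floor_le_of_le
  push_cast
  rw [mul_comm]
  apply mul_le_mul_of_nonneg_left _ (Nat.cast_nonneg n)
  refine le_trans ?_ (log_le_ell n)
  refine (le_abs_self _).trans ?_
  rw [Real.norm_eq_abs, one_mul, Real.norm_eq_abs] at hn
  refine hn.trans ?_
  simp only [Function.comp] at hn2
  rw [abs_of_nonneg (div_nonneg hn3 (by linarith))]
  exact div_le_self hn3 hn2

lemma per_n (u n m : ℕ) (hu : 2 ≤ u) (hr : 4 ≤ r) :
    ∃ μ : PMF ((Fin (Mnum F n) → FE n) × (Fin (Mnum F n) → FE n)),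
      UniformOn μ Prod.fst (ValidOrdH F n) ∧ UniformOn μ Prod.snd (ValidOrdH F n) ∧
      (((n : ℝ) ^ 2 ≤ Mnum F n ∧ 4 * r ≤ n ∧ 1 ≤ ell n ∧ 8 * ell n ≤ n ∧ m ≤ n * ell n) →
      ENNReal.ofReal (1 - eps r n) ≤
        μ.toOuterMeasure {ω | ∀ h ∈ proc ω.2 (THit F n ω.2),
                 h ∈ proc ω.1 (THit F n ω.1) ∧
                 ¬ ∃ h' ∈ proc ω.1 (THit F n ω.1 + m),
                     h' ∉ proc ω.1 (THit F n ω.1) ∧ Partner u h h'}) := by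
  by_cases hc : ((n : ℝ) ^ 2 ≤ Mnum F n ∧ 4 * r ≤ n ∧ 1 ≤ ell n ∧ 8 * ell n ≤ n ∧ m ≤ n * ell n)
  · obtain ⟨D, k, hk, hD, hb⟩ := main_bound F u n m hu hr hc.1 hc.2.1 hc.2.2.1 hc.2.2.2.1 hc.2.2.2.2
    obtain ⟨μ, a, b, c⟩ := coupling F u n (k := k) hD m
    refine ⟨μ, a, b, fun _ => le_trans ?_ c⟩
    apply ENNReal.ofReal_le_ofReal
    linarith
  · obtain ⟨μ, a, b, _⟩ := coupling F u n (k := 1) (D := Fintype.card (EE F n)) (fun h => Finset.card_le_univ _) m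
    exact ⟨μ, a, b, fun h => absurd h hc⟩

end

end HC

/-- One may couple the random `F`-graph process with another instance
`(H'_t)` of it so that whp `H'_{T_{H'}} ⊆ H_{T_H} \ 𝓕`, where `𝓕` is the set of
`F`-edges of `H_{T_H}` with a partner `F`-edge in `H_{T_H + ⌊g(n)n⌋} \ H_{T_H}`. -/
theorem statement_11 (u r : ℕ) (hu : 2 ≤ u) (hr : 4 ≤ r)
    (F : Finset (Finset (Fin r))) (hFcard : ∀ e ∈ F, e.card = u) (hF : Nice u F)
    (g : ℕ → ℝ) (hg : GoodG g) :
    ∃ μ : (n : ℕ) → PMF ((Fin (Mnum F n) → FE n) × (Fin (Mnum F n) → FE n)),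
      (∀ n, UniformOn (μ n) Prod.fst (ValidOrdH F n)) ∧
      (∀ n, UniformOn (μ n) Prod.snd (ValidOrdH F n)) ∧
      Tendsto (fun n => (μ n).toOuterMeasure
          {ω | ∀ h ∈ proc ω.2 (THit F n ω.2),
                 h ∈ proc ω.1 (THit F n ω.1) ∧
                 ¬ ∃ h' ∈ proc ω.1 (THit F n ω.1 + ⌊g n * (n : ℝ)⌋₊),
                     h' ∉ proc ω.1 (THit F n ω.1) ∧ Partner u h h'})
        atTop (nhds 1) := by
  choose μ h1 h2 h3 using fun n => HC.per_n F u n ⌊g n * (n : ℝ)⌋₊ hu hr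
  refine ⟨μ, h1, h2, ?_⟩
  have hlim : Tendsto (fun n => ENNReal.ofReal (1 - HC.eps r n)) atTop (nhds 1) := by
    have h := ENNReal.tendsto_ofReal ((tendsto_const_nhds (x := (1 : ℝ))).sub (HC.eps_tendsto r))
    simpa using h
  have hl1 : ∀ᶠ n : ℕ in atTop, 1 ≤ HC.ell n := by
    filter_upwards [HC.ell_tendsto.eventually_ge_atTop 1] with n hn
    exact_mod_cast hn
  refine tendsto_of_tendsto_of_tendsto_of_le_of_le' hlim tendsto_const_nhds ?_ ?_
  · filter_upwards [HC.M_large F hr, eventually_ge_atTop (4 * r), hl1, HC.ell_small, HC.g_small g hg] with n a b c d e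
    exact h3 n ⟨a, b, c, d, e⟩
  · filter_upwards with n
    refine (MeasureTheory.OuterMeasure.mono _ (Set.subset_univ _)).trans (le_of_eq ?_)
    change (μ n).toOuterMeasure Set.univ = 1
    rw [PMF.toOuterMeasure_apply_eq_one_iff]
    exact Set.subset_univ _
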